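/- arXiv:math/0506576 — 2 statements merged into one kernel-verified Lean document; each statement's English description precedes it below -/
import Mathlib

section
/- There exists Y > 0 such that for every τ in the upper half-plane ℍ with Im τ > Y, one has θ₃(τ)² = ₂F₁(1/2, 1/2; 1; θ₂(τ)⁴/θ₃(τ)⁴). -/
/- STATEMENT 9: `θ₃(τ)² = ₂F₁(1/2,1/2;1;θ₂(τ)⁴/θ₃(τ)⁴)` for `Im τ` large. -/

open Complex

/-- Gauss hypergeometric series `₂F₁(a,b;c;z)`. -/
noncomputable def hyp2F1 (a b c z : ℂ) : ℂ :=
  ∑' n : ℕ, ((ascPochhammer ℂ n).eval a * (ascPochhammer ℂ n).eval b) /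
    ((ascPochhammer ℂ n).eval c * (n.factorial : ℂ)) * z ^ n

/-- `q = e^{2πiτ}`. -/
noncomputable def qpar (τ : ℂ) : ℂ := Complex.exp (2 * (Real.pi : ℂ) * Complex.I * τ)

/-- `θ₂(τ) = q^{1/4} ∑_{n∈ℤ} q^{n(n+1)}`, with `q^{1/4} = e^{2πiτ/4}`. -/
noncomputable def theta2 (τ : ℂ) : ℂ :=
  Complex.exp (2 * (Real.pi : ℂ) * Complex.I * τ / 4) * ∑' n : ℤ, qpar τ ^ (n * (n + 1))

/-- `θ₃(τ) = ∑_{n∈ℤ} q^{n²}`. -/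
noncomputable def theta3 (τ : ℂ) : ℂ := ∑' n : ℤ, qpar τ ^ (n ^ 2)


/-- Splitting a double sum over `ℤ × ℤ` according to the parity of the sum of the indices. -/
theorem tsum_int_prod_parity {f : ℤ × ℤ → ℂ} (hf : Summable f) :
    ∑' p, f p = ∑' p : ℤ × ℤ, f (p.1 + p.2, p.1 - p.2)
      + ∑' p : ℤ × ℤ, f (p.1 + p.2 + 1, p.1 - p.2) := by
  set g : ℤ × ℤ → ℤ × ℤ := fun p => (p.1 + p.2, p.1 - p.2) with hg
  set h : ℤ × ℤ → ℤ × ℤ := fun p => (p.1 + p.2 + 1, p.1 - p.2) with hh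
  have hgi : Function.Injective g := by
    rintro ⟨a, b⟩ ⟨c, d⟩ H
    simp only [hg, Prod.mk.injEq] at H ⊢
    lia
  have hhi : Function.Injective h := by
    rintro ⟨a, b⟩ ⟨c, d⟩ H
    simp only [hh, Prod.mk.injEq] at H ⊢
    lia
  have hc : IsCompl (Set.range g) (Set.range h) := by
    refine ⟨Set.disjoint_left.2 ?_, codisjoint_iff_le_sup.2 ?_⟩
    · rintro _ ⟨⟨a, b⟩, rfl⟩ ⟨⟨c, d⟩, H⟩
      simp only [hg, hh, Prod.mk.injEq] at H
      lia
    · rintro ⟨a, b⟩ -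
      rcases Int.even_or_odd' (a + b) with ⟨c, hc | hc⟩
      · left
        exact ⟨(c, a - c), by simp only [hg, Prod.mk.injEq]; lia⟩
      · right
        exact ⟨(c, a - 1 - c), by simp only [hh, Prod.mk.injEq]; lia⟩
  exact (HasSum.add_isCompl hc
    (hgi.hasSum_range_iff.2 (hf.comp_injective hgi).hasSum)
    (hhi.hasSum_range_iff.2 (hf.comp_injective hhi).hasSum)).tsum_eq

/-- `∑ q ^ (n ^ 2)` over the integers. -/
noncomputable def squareSeries (q : ℂ) : ℂ := ∑' n : ℤ, q ^ (n ^ 2)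

/-- `∑ q ^ (n * (n + 1))` over the integers. -/
noncomputable def pronicSeries (q : ℂ) : ℂ := ∑' n : ℤ, q ^ (n * (n + 1))

theorem norm_zpow_le_pow_toNat {q : ℂ} {r : ℝ} (hq : ‖q‖ ≤ r) (hr : r < 1) {m : ℤ} {k : ℕ}
    (hk : (k : ℤ) ≤ m) : ‖q ^ m‖ ≤ r ^ k := by
  lift m to ℕ using (Int.natCast_nonneg k).trans hk
  rw [zpow_natCast, norm_pow]
  exact (pow_le_pow_left₀ (norm_nonneg q) hq m).trans
    (pow_le_pow_of_le_one ((norm_nonneg q).trans hq) hr.le (by exact_mod_cast hk))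

theorem norm_zpow_sq_le {q : ℂ} {r : ℝ} (hq : ‖q‖ ≤ r) (hr : r < 1) (n : ℤ) :
    ‖q ^ (n ^ 2)‖ ≤ r ^ n.natAbs := by
  apply norm_zpow_le_pow_toNat hq hr
  rw [← Int.natAbs_sq]
  exact_mod_cast Nat.le_self_pow two_ne_zero _

theorem norm_zpow_pronic_le {q : ℂ} {r : ℝ} (hq : ‖q‖ ≤ r) (hr : r < 1) (n : ℤ) :
    ‖q ^ (n * (n + 1))‖ ≤ r ^ (n.natAbs - 1) := by
  apply norm_zpow_le_pow_toNat hq hr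
  rcases le_or_gt 0 n with h | h
  · nlinarith [show ((n.natAbs - 1 : ℕ) : ℤ) ≤ n by lia]
  · nlinarith [show ((n.natAbs - 1 : ℕ) : ℤ) = -n - 1 by lia]

theorem summable_pow_natAbs {r : ℝ} (h0 : 0 ≤ r) (hr : r < 1) :
    Summable fun n : ℤ => r ^ n.natAbs :=
  .of_nat_of_neg (by simpa using summable_geometric_of_lt_one h0 hr)
    (by simpa using summable_geometric_of_lt_one h0 hr)

theorem summable_pow_natAbs_sub_one {r : ℝ} (h0 : 0 ≤ r) (hr : r < 1) :
    Summable fun n : ℤ => r ^ (n.natAbs - 1) := by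
  have : Summable fun n : ℕ => r ^ (n - 1) :=
    (summable_nat_add_iff 1).1 (by simpa using summable_geometric_of_lt_one h0 hr)
  exact .of_nat_of_neg (by simpa using this) (by simpa using this)

theorem summable_norm_zpow_sq {q : ℂ} (hq : ‖q‖ < 1) : Summable fun n : ℤ => ‖q ^ (n ^ 2)‖ :=
  .of_nonneg_of_le (fun _ => norm_nonneg _) (norm_zpow_sq_le le_rfl hq)
    (summable_pow_natAbs (norm_nonneg q) hq)

theorem summable_norm_zpow_pronic {q : ℂ} (hq : ‖q‖ < 1) :
    Summable fun n : ℤ => ‖q ^ (n * (n + 1))‖ :=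
  .of_nonneg_of_le (fun _ => norm_nonneg _) (norm_zpow_pronic_le le_rfl hq)
    (summable_pow_natAbs_sub_one (norm_nonneg q) hq)

theorem pronic_nonneg (n : ℤ) : 0 ≤ n * (n + 1) := by
  rcases le_or_gt 0 n with h | h <;> nlinarith

theorem continuousAt_squareSeries : ContinuousAt squareSeries 0 := by
  have : ContinuousOn squareSeries (Metric.closedBall 0 (1 / 2)) :=
    continuousOn_tsum
      (fun n q _ => (continuousAt_zpow₀ q _ (.inr (sq_nonneg n))).continuousWithinAt)
      (summable_pow_natAbs (r := 1 / 2) (by norm_num) (by norm_num))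
      (fun n q hq => norm_zpow_sq_le (by simpa using hq) (by norm_num) n)
  exact this.continuousAt (Metric.closedBall_mem_nhds _ (by norm_num))

theorem continuousAt_pronicSeries : ContinuousAt pronicSeries 0 := by
  have : ContinuousOn pronicSeries (Metric.closedBall 0 (1 / 2)) :=
    continuousOn_tsum
      (fun n q _ => (continuousAt_zpow₀ q _ (.inr (pronic_nonneg n))).continuousWithinAt)
      (summable_pow_natAbs_sub_one (r := 1 / 2) (by norm_num) (by norm_num))
      (fun n q hq => norm_zpow_pronic_le (by simpa using hq) (by norm_num) n)
  exact this.continuousAt (Metric.closedBall_mem_nhds _ (by norm_num))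

theorem squareSeries_zero : squareSeries 0 = 1 := by
  rw [squareSeries, tsum_eq_single 0 fun n hn => zero_zpow _ (pow_ne_zero 2 hn)]
  simp

/-- The theta identity `θ₃(q)² = θ₃(q²)² + θ₂(q²)²`. -/
theorem squareSeries_sq {q : ℂ} (h0 : q ≠ 0) (hq : ‖q‖ < 1) :
    squareSeries q ^ 2 = squareSeries (q ^ 2) ^ 2 + q * pronicSeries (q ^ 2) ^ 2 := by
  have hq2 : ‖q ^ 2‖ < 1 := by
    rw [norm_pow]; exact pow_lt_one₀ (norm_nonneg q) hq two_ne_zero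
  have hs := summable_norm_zpow_sq hq
  have hs2 := summable_norm_zpow_sq hq2
  have ht2 := summable_norm_zpow_pronic hq2
  rw [pow_two (squareSeries q), pow_two (squareSeries _), pow_two (pronicSeries _)]
  simp only [squareSeries, pronicSeries]
  rw [tsum_mul_tsum_of_summable_norm hs hs, tsum_mul_tsum_of_summable_norm hs2 hs2,
    tsum_mul_tsum_of_summable_norm ht2 ht2, ← tsum_mul_left,
    tsum_int_prod_parity (summable_mul_of_summable_norm hs hs)]
  congr 1 <;> refine tsum_congr fun p => ?_
  · rw [← zpow_natCast q 2, ← zpow_mul, ← zpow_mul, ← zpow_add₀ h0, ← zpow_add₀ h0]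
    congr 1; push_cast; ring
  · rw [← zpow_natCast q 2, ← zpow_mul, ← zpow_mul, ← zpow_add₀ h0, ← zpow_add₀ h0,
      ← zpow_one_add₀ h0]
    congr 1; push_cast; ring

/-- The theta identity `θ₂(q)² = 2 θ₂(q²) θ₃(q²)`. -/
theorem pronicSeries_sq {q : ℂ} (h0 : q ≠ 0) (hq : ‖q‖ < 1) :
    pronicSeries q ^ 2 = 2 * (pronicSeries (q ^ 2) * squareSeries (q ^ 2)) := by
  have hq2 : ‖q ^ 2‖ < 1 := by
    rw [norm_pow]; exact pow_lt_one₀ (norm_nonneg q) hq two_ne_zero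
  have ht := summable_norm_zpow_pronic hq
  have hs2 := summable_norm_zpow_sq hq2
  have ht2 := summable_norm_zpow_pronic hq2
  have hsum := summable_mul_of_summable_norm ht ht
  have hreflect : ∑' p : ℤ × ℤ, q ^ ((p.1 + p.2 + 1) * (p.1 + p.2 + 1 + 1))
        * q ^ ((p.1 - p.2) * (p.1 - p.2 + 1))
      = ∑' p : ℤ × ℤ, q ^ ((p.1 + p.2) * (p.1 + p.2 + 1))
        * q ^ ((p.1 - p.2) * (p.1 - p.2 + 1)) := by
    refine (tsum_congr fun p => ?_).trans (((Equiv.prodComm ℤ ℤ).trans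
      ((Equiv.refl ℤ).prodCongr (Equiv.addRight 1))).tsum_eq
        fun p : ℤ × ℤ => q ^ ((p.1 + p.2) * (p.1 + p.2 + 1)) * q ^ ((p.1 - p.2) * (p.1 - p.2 + 1)))
    simp only [Equiv.trans_apply, Equiv.prodComm_apply, Equiv.prodCongr_apply, Prod.map,
      Prod.fst_swap, Prod.snd_swap, Equiv.refl_apply, Equiv.coe_addRight]
    congr 2 <;> ring
  rw [pow_two (pronicSeries q)]
  simp only [squareSeries, pronicSeries]
  rw [tsum_mul_tsum_of_summable_norm ht ht, tsum_mul_tsum_of_summable_norm ht2 hs2,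
    tsum_int_prod_parity hsum, hreflect, ← two_mul]
  congr 1
  refine tsum_congr fun p => ?_
  rw [← zpow_natCast q 2, ← zpow_mul, ← zpow_mul, ← zpow_add₀ h0, ← zpow_add₀ h0]
  congr 1; push_cast; ring

theorem cast_centralBinom_succ (n : ℕ) :
    ((n + 1).centralBinom : ℂ) = 2 * (2 * n + 1) * n.centralBinom / (n + 1) := by
  rw [eq_div_iff n.cast_add_one_ne_zero, mul_comm]
  exact_mod_cast Nat.succ_mul_centralBinom_succ n

theorem ascPochhammer_eval_half (n : ℕ) :
    (ascPochhammer ℂ n).eval (1 / 2) = n.factorial * (n.centralBinom / 4 ^ n) := by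
  induction n with
  | zero => simp
  | succ n ih =>
    have hn : (n : ℂ) + 1 ≠ 0 := n.cast_add_one_ne_zero
    rw [ascPochhammer_succ_eval, ih, Nat.factorial_succ, pow_succ, cast_centralBinom_succ]
    push_cast
    field_simp
    ring

theorem hyp2F1_half_half_one (z : ℂ) :
    hyp2F1 (1 / 2) (1 / 2) 1 z = ∑' n : ℕ, ((n.centralBinom : ℂ) / 4 ^ n) ^ 2 * z ^ n := by
  refine tsum_congr fun n => ?_
  have : (n.factorial : ℂ) ≠ 0 := by exact_mod_cast n.factorial_ne_zero
  rw [ascPochhammer_eval_half, ascPochhammer_eval_one]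
  field_simp

theorem centralBinom_le_four_pow (n : ℕ) : n.centralBinom ≤ 4 ^ n := by
  rw [Nat.centralBinom, show 4 = 2 ^ 2 by rfl, ← pow_mul]
  exact Nat.choose_le_two_pow _ _

theorem norm_centralBinom_div_le (n : ℕ) : ‖((n.centralBinom : ℂ) / 4 ^ n) ^ 2‖ ≤ 1 := by
  have : (n.centralBinom : ℝ) ≤ 4 ^ n := by exact_mod_cast centralBinom_le_four_pow n
  rw [norm_pow, norm_div, norm_pow, norm_natCast, norm_ofNat]
  exact pow_le_one₀ (by positivity) (div_le_one_of_le₀ this (by positivity))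

theorem continuousAt_hyp2F1_half_half_one : ContinuousAt (hyp2F1 (1 / 2) (1 / 2) 1) 0 := by
  have : ContinuousOn (hyp2F1 (1 / 2) (1 / 2) 1) (Metric.closedBall 0 (1 / 2)) := by
    rw [funext hyp2F1_half_half_one]
    refine continuousOn_tsum (u := fun n : ℕ => (1 / 2 : ℝ) ^ n)
      (fun n => by fun_prop) (summable_geometric_of_lt_one (by norm_num) (by norm_num))
      fun n z hz => ?_
    rw [norm_mul, norm_pow z]
    exact (mul_le_of_le_one_left (by positivity) (norm_centralBinom_div_le n)).trans
      (pow_le_pow_left₀ (norm_nonneg z) (by simpa using hz) n)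
  exact this.continuousAt (Metric.closedBall_mem_nhds _ (by norm_num))

theorem hyp2F1_half_half_one_zero : hyp2F1 (1 / 2) (1 / 2) 1 0 = 1 := by
  rw [hyp2F1_half_half_one, tsum_eq_single 0 fun n hn => by simp [hn]]
  simp

/-- Up to sign, the coefficient of `k ^ m` in
`(1 + k)⁻¹ * hyp2F1 (1 / 2) (1 / 2) 1 (4 * k / (1 + k) ^ 2)`. -/
noncomputable def landenCoeff (m : ℕ) : ℂ :=
  ∑ n ∈ Finset.range (m + 1), (-1) ^ n * ((n.centralBinom : ℂ) ^ 2 / 4 ^ n) * (m + n).choose (2 * n)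

theorem landenCoeff_eq_sum_range {m N : ℕ} (h : m < N) :
    landenCoeff m = ∑ n ∈ Finset.range N,
      (-1) ^ n * ((n.centralBinom : ℂ) ^ 2 / 4 ^ n) * (m + n).choose (2 * n) := by
  refine Finset.sum_subset (Finset.range_mono h) fun n _ hn => ?_
  rw [Nat.choose_eq_zero_of_lt (by simp at hn; lia)]
  simp

theorem cast_choose_succ_mul (n k : ℕ) :
    (n.choose (k + 1) : ℂ) * (k + 1) = n.choose k * (n - k) := by
  rcases le_or_gt k n with h | h
  · rw [← Nat.cast_sub h]
    exact_mod_cast Nat.choose_succ_right_eq n k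
  · simp [Nat.choose_eq_zero_of_lt h, Nat.choose_eq_zero_of_lt (h.trans k.lt_succ_self)]

/-- Zeilberger's telescoping identity behind the recurrence of `landenCoeff`. -/
theorem sum_range_landen_telescope (m N : ℕ) :
    ∑ n ∈ Finset.range (N + 1), (-1) ^ n * ((n.centralBinom : ℂ) ^ 2 / 4 ^ n) *
        (((m : ℂ) + 2) ^ 2 * (m + 2 + n).choose (2 * n)
          - ((m : ℂ) + 1) ^ 2 * (m + n).choose (2 * n))
      = (2 * (m : ℂ) + 3) * (2 * N + 1) * (-1) ^ N * ((N.centralBinom : ℂ) ^ 2 / 4 ^ N)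
        * (m + N + 1).choose (2 * N) := by
  induction N with
  | zero => simp; ring
  | succ N ih =>
    have hN : (N : ℂ) + 1 ≠ 0 := N.cast_add_one_ne_zero
    have hy := cast_choose_succ_mul (m + N + 1) (2 * N)
    have hz := cast_choose_succ_mul (m + N + 1) (2 * N + 1)
    rw [Finset.sum_range_succ, ih, cast_centralBinom_succ,
      show 2 * (N + 1) = 2 * N + 1 + 1 by ring,
      show m + 2 + (N + 1) = m + N + 1 + 1 + 1 by ring,
      show m + (N + 1) + 1 = m + N + 1 + 1 by ring, show m + (N + 1) = m + N + 1 by ring,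
      Nat.choose_succ_succ' (m + N + 1 + 1) (2 * N + 1),
      Nat.choose_succ_succ' (m + N + 1) (2 * N + 1), Nat.choose_succ_succ' (m + N + 1) (2 * N)]
    generalize (m + N + 1).choose (2 * N) = x at *
    generalize (m + N + 1).choose (2 * N + 1) = y at *
    generalize (m + N + 1).choose (2 * N + 1 + 1) = z at *
    push_cast at hy hz ⊢
    have key : (2 * m + 3) * (N + 1) ^ 2 * x
        - (2 * N + 1) * ((m + 2) ^ 2 * (x + 2 * y + z) - (m + 1) ^ 2 * z)
        + (2 * N + 1) * (2 * m + 3) * (2 * N + 3) * (y + z) = (0 : ℂ) := by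
      linear_combination (2 * m * N + m + 3 * N + 1 : ℂ) * hy + (2 * m + 3) * (2 * N + 1 : ℂ) * hz
    rw [pow_succ, pow_succ]
    field_simp
    linear_combination 4 * (2 * N + 1 : ℂ) * (-1) ^ N * (N.centralBinom : ℂ) ^ 2 * 4 ^ N * key

theorem landenCoeff_add_two (m : ℕ) :
    (m + 2) ^ 2 * landenCoeff (m + 2) = (m + 1) ^ 2 * landenCoeff m := by
  have h := sum_range_landen_telescope m (m + 2)
  rw [Nat.choose_eq_zero_of_lt (show m + (m + 2) + 1 < 2 * (m + 2) by lia)] at h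
  rw [← sub_eq_zero, landenCoeff_eq_sum_range (Nat.lt_succ_self (m + 2)),
    landenCoeff_eq_sum_range (show m < m + 2 + 1 by lia), Finset.mul_sum, Finset.mul_sum,
    ← Finset.sum_sub_distrib]
  rw [Nat.cast_zero, mul_zero] at h
  rw [← h]
  refine Finset.sum_congr rfl fun n _ => ?_
  ring

theorem landenCoeff_odd (l : ℕ) : landenCoeff (2 * l + 1) = 0 := by
  induction l with
  | zero => norm_num [landenCoeff, Finset.sum_range_succ, Nat.centralBinom, Nat.choose]
  | succ l ih =>
    have h := landenCoeff_add_two (2 * l + 1)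
    rw [ih, mul_zero] at h
    exact (mul_eq_zero.1 h).resolve_left (by norm_cast; positivity)

theorem landenCoeff_even (l : ℕ) :
    landenCoeff (2 * l) = ((l.centralBinom : ℂ) / 4 ^ l) ^ 2 := by
  induction l with
  | zero => simp [landenCoeff]
  | succ l ih =>
    have h := landenCoeff_add_two (2 * l)
    have hl : (l : ℂ) + 1 ≠ 0 := l.cast_add_one_ne_zero
    rw [ih] at h
    have h2 : ((2 * l : ℕ) + 2 : ℂ) ^ 2 ≠ 0 := by norm_cast; positivity
    refine mul_left_cancel₀ h2 (h.trans ?_)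
    rw [cast_centralBinom_succ, pow_succ]
    push_cast
    field_simp
    ring

theorem one_add_ne_zero_of_norm_le {k : ℂ} (hk : ‖k‖ ≤ 1 / 10) : 1 + k ≠ 0 := fun h => by
  rw [eq_neg_of_add_eq_zero_right h] at hk
  norm_num at hk

theorem summable_landen {k : ℂ} (hk : ‖k‖ ≤ 1 / 10) :
    Summable fun p : ℕ × ℕ => ((p.1.centralBinom : ℂ) ^ 2 / 4 ^ p.1) * k ^ p.1 *
      ((p.2 + 2 * p.1).choose (2 * p.1) * (-k) ^ p.2) := by
  have hr : ‖‖k‖‖ < 1 := by rw [norm_norm]; linarith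
  have hs (n : ℕ) := hasSum_choose_mul_geometric_of_norm_lt_one (2 * n) hr
  refine .of_norm ((summable_prod_of_nonneg fun _ => norm_nonneg _).2 ⟨fun n => ?_, ?_⟩)
  · simp only [norm_mul _ (_ * _)]
    refine .mul_left _ ?_
    simpa using (hs n).summable
  · simp only [norm_mul _ (_ * _), tsum_mul_left]
    refine .of_nonneg_of_le (f := fun n => 2 * (1 / 2 : ℝ) ^ n)
      (fun n => mul_nonneg (norm_nonneg _) (tsum_nonneg fun _ => norm_nonneg _)) (fun n => ?_)
      ((summable_geometric_of_lt_one (by norm_num) (by norm_num)).mul_left 2)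
    have ht : ∑' j : ℕ, ‖((j + 2 * n).choose (2 * n) : ℂ) * (-k) ^ j‖
        = 1 / (1 - ‖k‖) ^ (2 * n + 1) := by
      simpa using (hs n).tsum_eq
    have hb : (n.centralBinom : ℝ) ≤ 4 ^ n := by exact_mod_cast centralBinom_le_four_pow n
    have hd : (n.centralBinom : ℝ) ^ 2 / 4 ^ n ≤ 4 ^ n := by
      rw [div_le_iff₀ (by positivity), pow_two]
      gcongr
    have hk' : 9 / 10 ≤ 1 - ‖k‖ := by linarith
    rw [ht, norm_mul, norm_div, norm_pow, norm_pow, norm_pow, norm_natCast, norm_ofNat]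
    calc (n.centralBinom : ℝ) ^ 2 / 4 ^ n * ‖k‖ ^ n * (1 / (1 - ‖k‖) ^ (2 * n + 1))
        ≤ 4 ^ n * (1 / 10) ^ n * (1 / (9 / 10) ^ (2 * n + 1)) := by gcongr
      _ = (10 / 9) * (40 / 81) ^ n := by
        rw [show (40 / 81 : ℝ) = 4 * (1 / 10) / (9 / 10) ^ 2 by norm_num,
          div_pow (4 * (1 / 10) : ℝ), mul_pow, pow_succ, pow_mul]
        ring
      _ ≤ 2 * (1 / 2) ^ n :=
        mul_le_mul (by norm_num) (pow_le_pow_left₀ (by norm_num) (by norm_num) n)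
          (by positivity) (by norm_num)

/-- The Landen transformation for the complete elliptic integral of the first kind. -/
theorem hyp2F1_landen {k : ℂ} (hk : ‖k‖ ≤ 1 / 10) :
    hyp2F1 (1 / 2) (1 / 2) 1 (4 * k / (1 + k) ^ 2)
      = (1 + k) * hyp2F1 (1 / 2) (1 / 2) 1 (k ^ 2) := by
  have hk1 := one_add_ne_zero_of_norm_le hk
  have hnk : ‖-k‖ < 1 := by rw [norm_neg]; linarith
  have hf := summable_landen hk
  have hleft := hf.tsum_prod
  have hright := Finset.HasAntidiagonal.sigmaAntidiagonalEquivProd.tsum_eq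
    fun p : ℕ × ℕ => ((p.1.centralBinom : ℂ) ^ 2 / 4 ^ p.1) * k ^ p.1 *
      ((p.2 + 2 * p.1).choose (2 * p.1) * (-k) ^ p.2)
  replace hright := ((Finset.HasAntidiagonal.sigmaAntidiagonalEquivProd.summable_iff.2
    hf).tsum_sigma' fun m => (hasSum_fintype _).summable).symm.trans (hright.trans hleft)
  simp only [Function.comp_apply, Finset.HasAntidiagonal.sigmaAntidiagonalEquivProd_apply]
    at hright
  have hcoeff (m : ℕ) : ∑' c : Finset.HasAntidiagonal.antidiagonal m,
      ((c.1.1.centralBinom : ℂ) ^ 2 / 4 ^ c.1.1) * k ^ c.1.1 *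
        ((c.1.2 + 2 * c.1.1).choose (2 * c.1.1) * (-k) ^ c.1.2)
      = landenCoeff m * (-k) ^ m := by
    rw [Finset.tsum_subtype (Finset.HasAntidiagonal.antidiagonal m) fun c : ℕ × ℕ =>
      ((c.1.centralBinom : ℂ) ^ 2 / 4 ^ c.1) * k ^ c.1 *
        ((c.2 + 2 * c.1).choose (2 * c.1) * (-k) ^ c.2),
      Finset.Nat.sum_antidiagonal_eq_sum_range_succ_mk, landenCoeff, Finset.sum_mul]
    refine Finset.sum_congr rfl fun n hn => ?_
    obtain ⟨j, rfl⟩ := Nat.exists_eq_add_of_le (Finset.mem_range_succ_iff.1 hn)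
    have hsign : ((-1 : ℂ) ^ n) * (-1) ^ n = 1 := by rw [← mul_pow]; simp
    rw [Nat.add_sub_cancel_left, show n + j + n = j + 2 * n by ring, pow_add (-k), neg_pow k n]
    linear_combination (-((n.centralBinom : ℂ) ^ 2 / 4 ^ n * k ^ n *
      ((j + 2 * n).choose (2 * n) * (-k) ^ j))) * hsign
  have hinner (n : ℕ) : ∑' j : ℕ, ((n.centralBinom : ℂ) ^ 2 / 4 ^ n) * k ^ n *
        ((j + 2 * n).choose (2 * n) * (-k) ^ j)
      = (1 + k)⁻¹ * (((n.centralBinom : ℂ) / 4 ^ n) ^ 2 * (4 * k / (1 + k) ^ 2) ^ n) := by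
    rw [tsum_mul_left, tsum_choose_mul_geometric_of_norm_lt_one (2 * n) hnk, sub_neg_eq_add,
      div_pow (4 * k), mul_pow, ← pow_mul]
    field_simp
    ring
  have heven : HasSum (fun l : ℕ => landenCoeff (2 * l) * (-k) ^ (2 * l))
      (hyp2F1 (1 / 2) (1 / 2) 1 (k ^ 2)) := by
    simp only [landenCoeff_even, pow_mul _ 2, neg_sq]
    rw [hyp2F1_half_half_one]
    refine (Summable.of_norm_bounded
      (summable_geometric_of_lt_one (norm_nonneg (k ^ 2)) ?_) fun l => ?_).hasSum
    · rw [norm_pow]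
      exact pow_lt_one₀ (norm_nonneg k) (by linarith) two_ne_zero
    · rw [norm_mul, norm_pow (k ^ 2)]
      exact mul_le_of_le_one_left (by positivity) (norm_centralBinom_div_le l)
  have hodd : HasSum (fun l : ℕ => landenCoeff (2 * l + 1) * (-k) ^ (2 * l + 1)) 0 := by
    simp only [landenCoeff_odd, zero_mul]
    exact hasSum_zero
  have hsum := (HasSum.even_add_odd (f := fun m => landenCoeff m * (-k) ^ m) heven hodd).tsum_eq
  rw [add_zero, ← tsum_congr hcoeff] at hsum
  simp only [hinner, tsum_mul_left, ← hyp2F1_half_half_one] at hright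
  rw [← hsum]
  exact (inv_mul_eq_iff_eq_mul₀ hk1).1 hright.symm

/-- The modular lambda function as a function of the nome. -/
noncomputable def nomeLambda (q : ℂ) : ℂ := q * pronicSeries q ^ 4 / squareSeries q ^ 4

theorem continuousAt_nomeLambda : ContinuousAt nomeLambda 0 :=
  (continuousAt_id.mul (continuousAt_pronicSeries.pow 4)).div (continuousAt_squareSeries.pow 4)
    (by simp [squareSeries_zero])

theorem nomeLambda_zero : nomeLambda 0 = 0 := by simp [nomeLambda]

/-- One step of the arithmetic-geometric mean iteration, in terms of theta series. -/
theorem hyp2F1_nomeLambda_step {q : ℂ} (h0 : q ≠ 0) (hq : ‖q‖ < 1)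
    (hS : squareSeries q ≠ 0) (hS2 : squareSeries (q ^ 2) ≠ 0)
    (hk : ‖q * pronicSeries (q ^ 2) ^ 2 / squareSeries (q ^ 2) ^ 2‖ ≤ 1 / 10) :
    hyp2F1 (1 / 2) (1 / 2) 1 (nomeLambda q) / squareSeries q ^ 2
      = hyp2F1 (1 / 2) (1 / 2) 1 (nomeLambda (q ^ 2)) / squareSeries (q ^ 2) ^ 2 := by
  have hsq := squareSeries_sq h0 hq
  have hpr := pronicSeries_sq h0 hq
  have h := hyp2F1_landen hk
  have h1 : 1 + q * pronicSeries (q ^ 2) ^ 2 / squareSeries (q ^ 2) ^ 2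
      = squareSeries q ^ 2 / squareSeries (q ^ 2) ^ 2 := by
    rw [hsq]; field_simp
  have h2 : 4 * (q * pronicSeries (q ^ 2) ^ 2 / squareSeries (q ^ 2) ^ 2)
      / (squareSeries q ^ 2 / squareSeries (q ^ 2) ^ 2) ^ 2 = nomeLambda q := by
    rw [nomeLambda, show pronicSeries q ^ 4 = (pronicSeries q ^ 2) ^ 2 by ring, hpr]
    field_simp
    ring
  have h3 : (q * pronicSeries (q ^ 2) ^ 2 / squareSeries (q ^ 2) ^ 2) ^ 2
      = nomeLambda (q ^ 2) := by
    rw [nomeLambda]; ring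
  rw [h1, h2, h3] at h
  rw [h]
  field_simp

theorem exists_pos_squareSeries_sq_eq_hyp2F1 :
    ∃ ε : ℝ, 0 < ε ∧ ∀ q : ℂ, q ≠ 0 → ‖q‖ < ε →
      squareSeries q ≠ 0 ∧
        squareSeries q ^ 2 = hyp2F1 (1 / 2) (1 / 2) 1 (nomeLambda q) := by
  have hSne : ∀ᶠ q in nhds (0 : ℂ), squareSeries q ≠ 0 :=
    continuousAt_squareSeries.eventually_ne (by simp [squareSeries_zero])
  have hkcont : ContinuousAt
      (fun q : ℂ => q * pronicSeries (q ^ 2) ^ 2 / squareSeries (q ^ 2) ^ 2) 0 := by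
    have hS : ContinuousAt (fun q : ℂ => squareSeries (q ^ 2)) 0 :=
      continuousAt_squareSeries.comp_of_eq (continuousAt_id.pow 2) (by simp)
    have hT : ContinuousAt (fun q : ℂ => pronicSeries (q ^ 2)) 0 :=
      continuousAt_pronicSeries.comp_of_eq (continuousAt_id.pow 2) (by simp)
    exact (continuousAt_id.mul (hT.pow 2)).div (hS.pow 2) (by simp [squareSeries_zero])
  have hksmall : ∀ᶠ q in nhds (0 : ℂ),
      ‖q * pronicSeries (q ^ 2) ^ 2 / squareSeries (q ^ 2) ^ 2‖ < 1 / 10 :=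
    hkcont.norm.eventually_lt continuousAt_const (by simp)
  obtain ⟨ε, hε, hball⟩ := Metric.eventually_nhds_iff.1 (hSne.and hksmall)
  refine ⟨min ε 1, by positivity, fun q hq0 hq => ?_⟩
  have hq1 : ‖q‖ < 1 := hq.trans_le (min_le_right _ _)
  have hpow (n : ℕ) : ‖q ^ 2 ^ n‖ ≤ ‖q‖ := by
    rw [norm_pow]
    exact pow_le_of_le_one (norm_nonneg q) hq1.le (by positivity)
  have hgood (n : ℕ) := hball (y := q ^ 2 ^ n)
    (by rw [dist_zero_right]; exact (hpow n).trans_lt (hq.trans_le (min_le_left _ _)))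
  set g : ℂ → ℂ := fun q => hyp2F1 (1 / 2) (1 / 2) 1 (nomeLambda q) / squareSeries q ^ 2 with hg
  have hiter (n : ℕ) : g (q ^ 2 ^ n) = g q := by
    induction n with
    | zero => simp
    | succ n ih =>
      have hnext : (q ^ 2 ^ n) ^ 2 = q ^ 2 ^ (n + 1) := by rw [← pow_mul, pow_succ]
      rw [← ih, ← hnext]
      exact (hyp2F1_nomeLambda_step (pow_ne_zero _ hq0) ((hpow n).trans_lt hq1) (hgood n).1
        (hnext ▸ (hgood (n + 1)).1) (hgood n).2.le).symm
  have hgcont : ContinuousAt g 0 :=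
    (continuousAt_hyp2F1_half_half_one.comp_of_eq continuousAt_nomeLambda nomeLambda_zero).div
      (continuousAt_squareSeries.pow 2) (by simp [squareSeries_zero])
  have hlim : Filter.Tendsto (fun n : ℕ => q ^ 2 ^ n) Filter.atTop (nhds 0) :=
    (tendsto_pow_atTop_nhds_zero_of_norm_lt_one hq1).comp
      (tendsto_pow_atTop_atTop_of_one_lt one_lt_two)
  have hgq : g q = g 0 :=
    tendsto_nhds_unique (tendsto_const_nhds.congr fun n => (hiter n).symm)
      (hgcont.tendsto.comp hlim)
  have hS : squareSeries q ≠ 0 := by simpa using (hgood 0).1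
  have hg0 : g 0 = 1 := by
    simp only [hg, nomeLambda_zero, squareSeries_zero, hyp2F1_half_half_one_zero, one_pow, div_one]
  rw [hg0, hg] at hgq
  exact ⟨hS, ((div_eq_one_iff_eq (pow_ne_zero 2 hS)).1 hgq).symm⟩

theorem theta2_pow_four (τ : ℂ) : theta2 τ ^ 4 = qpar τ * pronicSeries (qpar τ) ^ 4 := by
  rw [theta2, mul_pow, ← Complex.exp_nat_mul, qpar, pronicSeries]
  congr 2
  push_cast
  ring

theorem norm_qpar (τ : ℂ) : ‖qpar τ‖ = Real.exp (-(2 * Real.pi * τ.im)) := by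
  rw [qpar, Complex.norm_exp]
  simp

theorem stmt9 :
    ∃ Y : ℝ, 0 < Y ∧ ∀ τ : ℂ, Y < τ.im →
      theta3 τ ^ 2 = hyp2F1 (1/2) (1/2) 1 (theta2 τ ^ 4 / theta3 τ ^ 4) := by
  obtain ⟨ε, hε, h⟩ := exists_pos_squareSeries_sq_eq_hyp2F1
  refine ⟨1 + |Real.log ε|, by positivity, fun τ hτ => ?_⟩
  have hlt : ‖qpar τ‖ < ε := by
    rw [norm_qpar, ← Real.lt_log_iff_exp_lt hε]
    nlinarith [Real.pi_gt_three, neg_abs_le (Real.log ε), abs_nonneg (Real.log ε)]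
  rw [theta2_pow_four]
  exact (h (qpar τ) (Complex.exp_ne_zero _) hlt).2
end

section
/- There exists Y > 0 such that for every τ in the upper half-plane ℍ with Im τ > Y, setting s(τ) = −64·η(2τ)²⁴/η(τ)²⁴, one has 2E₂(2τ) − E₂(τ) = (1 − s(τ))^{1/2} · ₂F₁(1/4, 1/4; 1; s(τ))², where the power is the principal branch. -/
open Complex

/-- Normalized Eisenstein series of weight 2: `E₂(τ) = 1 − 24 ∑_{n≥1} n qⁿ/(1−qⁿ)`. -/
noncomputable def Eis2 (τ : ℂ) : ℂ :=
  1 - 24 * ∑' n : ℕ, ((n : ℂ) + 1) * qpar τ ^ (n + 1) / (1 - qpar τ ^ (n + 1))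

/-- Dedekind eta function `η(τ) = q^{1/24} ∏_{n≥1} (1 − qⁿ)`, `q^{1/24} = e^{2πiτ/24}`. -/
noncomputable def dedekindEta (τ : ℂ) : ℂ :=
  Complex.exp (2 * (Real.pi : ℂ) * Complex.I * τ / 24) * ∏' n : ℕ, (1 - qpar τ ^ (n + 1))

/- STATEMENT 11: with `s = −64 η(2τ)²⁴/η(τ)²⁴`,
`2E₂(2τ) − E₂(τ) = (1−s)^{1/2} ₂F₁(1/4,1/4;1;s)²` for `Im τ` large. -/

/-- Coefficients of the series `₂F₁(1/4,1/4;1;z)`. -/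
noncomputable def hypCoeff (n : ℕ) : ℂ :=
  ((ascPochhammer ℂ n).eval (1 / 4) * (ascPochhammer ℂ n).eval (1 / 4)) /
    ((ascPochhammer ℂ n).eval 1 * (n.factorial : ℂ))

lemma hypCoeff_zero : hypCoeff 0 = 1 := by simp [hypCoeff]

lemma hypCoeff_succ (n : ℕ) :
    ((n : ℂ) + 1) ^ 2 * hypCoeff (n + 1) = ((n : ℂ) + 1 / 4) ^ 2 * hypCoeff n := by
  have h1 : (n : ℂ) + 1 ≠ 0 := Nat.cast_add_one_ne_zero n
  have h2 : (n.factorial : ℂ) ≠ 0 := by exact_mod_cast n.factorial_ne_zero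
  simp only [hypCoeff, ascPochhammer_eval_one, ascPochhammer_succ_eval, Nat.factorial_succ]
  push_cast
  have h3 : 1 + (n : ℂ) ≠ 0 := by rwa [add_comm]
  field_simp
  ring

lemma norm_hypCoeff_le_one (n : ℕ) : ‖hypCoeff n‖ ≤ 1 := by
  induction n with
  | zero => simp [hypCoeff_zero]
  | succ n ih =>
    have h := congrArg norm (hypCoeff_succ n)
    have h1 : ‖(n : ℂ) + 1‖ = n + 1 := by
      exact_mod_cast Complex.norm_natCast (n + 1)
    have h2 : ‖(n : ℂ) + 1 / 4‖ = n + 1 / 4 := by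
      rw [show (n : ℂ) + 1 / 4 = (((n : ℝ) + 1 / 4 : ℝ) : ℂ) by push_cast; ring,
        Complex.norm_of_nonneg (by positivity)]
    rw [norm_mul, norm_mul, norm_pow, norm_pow, h1, h2] at h
    have hn : (0 : ℝ) ≤ n := n.cast_nonneg
    have h3 : ((n : ℝ) + 1 / 4) ^ 2 ≤ ((n : ℝ) + 1) ^ 2 := by gcongr; norm_num
    have h4 : ((n : ℝ) + 1) ^ 2 * ‖hypCoeff (n + 1)‖ ≤ ((n : ℝ) + 1) ^ 2 * 1 := by
      rw [h]
      calc _ ≤ ((n : ℝ) + 1 / 4) ^ 2 * 1 := by gcongr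
        _ ≤ _ := by linarith
    exact le_of_mul_le_mul_left h4 (by positivity)

/-- The series `∑ nᵏ aₙ zⁿ`, obtained by applying `z d/dz` to `₂F₁(1/4,1/4;1;z)` `k` times. -/
noncomputable def hypTheta (k : ℕ) (z : ℂ) : ℂ := ∑' n : ℕ, (n : ℂ) ^ k * hypCoeff n * z ^ n

lemma hyp2F1_eq_hypTheta (z : ℂ) : hyp2F1 (1 / 4) (1 / 4) 1 z = hypTheta 0 z := by
  simp [hyp2F1, hypTheta, hypCoeff]

lemma norm_hypTheta_term_le (k n : ℕ) (z : ℂ) :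
    ‖(n : ℂ) ^ k * hypCoeff n * z ^ n‖ ≤ (n : ℝ) ^ k * ‖z‖ ^ n := by
  rw [norm_mul, norm_mul, norm_pow, norm_pow, Complex.norm_natCast]
  have := norm_hypCoeff_le_one n
  have h0 : (0 : ℝ) ≤ (n : ℝ) ^ k * ‖z‖ ^ n := by positivity
  calc _ = ((n : ℝ) ^ k * ‖z‖ ^ n) * ‖hypCoeff n‖ := by ring
    _ ≤ ((n : ℝ) ^ k * ‖z‖ ^ n) * 1 := by gcongr
    _ = _ := mul_one _

lemma summable_hypTheta (k : ℕ) {z : ℂ} (hz : ‖z‖ < 1) :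
    Summable fun n : ℕ ↦ (n : ℂ) ^ k * hypCoeff n * z ^ n :=
  .of_norm_bounded (summable_pow_mul_geometric_of_norm_lt_one k (by simpa using hz))
    fun n ↦ norm_hypTheta_term_le k n z

lemma exists_hasDerivAt_hypTheta (k : ℕ) {z : ℂ} (hz : ‖z‖ < 1) :
    ∃ d, HasDerivAt (hypTheta k) d z ∧ z * d = hypTheta (k + 1) z := by
  obtain ⟨r, hzr, hr⟩ := exists_between hz
  have hr0 : 0 < r := (norm_nonneg z).trans_lt hzr
  refine ⟨∑' n : ℕ, (n : ℂ) ^ k * hypCoeff n * (n * z ^ (n - 1)), ?_, ?_⟩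
  · have hu : Summable fun n : ℕ ↦ (n : ℝ) ^ (k + 1) * r ^ n * r⁻¹ :=
      (summable_pow_mul_geometric_of_norm_lt_one (R := ℝ) (r := r) (k + 1)
        (by rwa [Real.norm_of_nonneg hr0.le])).mul_right _
    have hd (n : ℕ) (y : ℂ) (_ : y ∈ Metric.ball (0 : ℂ) r) :
        HasDerivAt (fun z : ℂ ↦ (n : ℂ) ^ k * hypCoeff n * z ^ n)
          ((n : ℂ) ^ k * hypCoeff n * (n * y ^ (n - 1))) y := (hasDerivAt_pow n y).const_mul _
    refine hasDerivAt_tsum_of_isPreconnected hu Metric.isOpen_ball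
      (convex_ball _ _).isPreconnected hd (fun n y hy ↦ ?_)
      (Metric.mem_ball_self hr0) (summable_hypTheta k (by simp)) (by simpa using hzr)
    rcases n with _ | n
    · simp
    have hy' : ‖y‖ ≤ r := (mem_ball_zero_iff.mp hy).le
    have h := norm_hypCoeff_le_one (n + 1)
    rw [norm_mul, norm_mul, norm_mul, norm_pow, norm_pow, Complex.norm_natCast]
    calc _ = (((n + 1 : ℕ) : ℝ) ^ (k + 1) * ‖y‖ ^ n) * ‖hypCoeff (n + 1)‖ := by
          simp only [Nat.add_sub_cancel]; ring
      _ ≤ (((n + 1 : ℕ) : ℝ) ^ (k + 1) * r ^ n) * 1 := by gcongr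
      _ = _ := by field_simp; ring
  · rw [hypTheta, ← tsum_mul_left]
    congr 1 with n
    rcases n with _ | n
    · simp
    · simp only [Nat.add_sub_cancel]; ring

lemma hypTheta_zero_zero : hypTheta 0 0 = 1 := by
  rw [hypTheta, tsum_eq_single 0 fun n hn ↦ by simp [hn]]
  simp [hypCoeff_zero]

lemma hypTheta_one_zero : hypTheta 1 0 = 0 := by
  rw [hypTheta, tsum_eq_single 0 fun n hn ↦ by simp [hn]]
  simp

lemma continuousAt_hypTheta (k : ℕ) : ContinuousAt (hypTheta k) 0 :=
  let ⟨_, h, _⟩ := exists_hasDerivAt_hypTheta k (z := 0) (by simp)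
  h.continuousAt

/-- The hypergeometric differential equation. -/
lemma hypTheta_two {z : ℂ} (hz : ‖z‖ < 1) :
    (1 - z) * hypTheta 2 z = z * (hypTheta 1 z / 2 + hypTheta 0 z / 16) := by
  have h : hypTheta 2 z = z * (hypTheta 2 z + hypTheta 1 z / 2 + hypTheta 0 z / 16) := by
    have hs := ((summable_hypTheta 2 hz).hasSum.add
      ((summable_hypTheta 1 hz).hasSum.div_const 2)).add
      ((summable_hypTheta 0 hz).hasSum.div_const 16) |>.mul_left z
    have h2 := (summable_hypTheta 2 hz).hasSum
    rw [← hasSum_nat_add_iff' 1] at h2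
    simp only [Finset.sum_range_one, Nat.cast_zero, ne_eq, OfNat.ofNat_ne_zero,
      not_false_eq_true, zero_pow, zero_mul, sub_zero] at h2
    refine h2.unique (hs.congr_fun fun n ↦ ?_)
    have := hypCoeff_succ n
    push_cast
    rw [this]
    ring
  linear_combination h

open Filter Topology

lemma eq_of_deriv_eq_zero_of_tendsto {Y : ℝ} {f : ℂ → ℂ} {a : ℂ}
    (hf : ∀ z : ℂ, Y < z.im → HasDerivAt f 0 z) (ha : Tendsto f (comap Complex.im atTop) (𝓝 a))
    {z : ℂ} (hz : Y < z.im) : f z = a := by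
  have hopen : IsOpen {z : ℂ | Y < z.im} := isOpen_lt continuous_const Complex.continuous_im
  have hconst {w : ℂ} (hw : Y < w.im) : f w = f z :=
    hopen.is_const_of_deriv_eq_zero (convex_halfSpace_im_gt Y).isPreconnected
      (fun w hw ↦ (hf w hw).differentiableAt.differentiableWithinAt)
      (fun w hw ↦ (hf w hw).deriv) hw hz
  have : (comap Complex.im atTop).NeBot := by
    refine comap_neBot fun t ht ↦ ?_
    obtain ⟨x, hx⟩ := nonempty_of_mem ht
    exact ⟨⟨0, x⟩, hx⟩
  refine tendsto_nhds_unique (tendsto_const_nhds.congr' ?_) ha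
  filter_upwards [preimage_mem_comap (Ioi_mem_atTop Y)] with w hw
  exact (hconst hw).symm

lemma eq_of_sq_eq_sq_of_re_pos {x y : ℂ} (h : x ^ 2 = y ^ 2) (hx : 0 < x.re) (hy : 0 < y.re) :
    x = y := by
  rcases sq_eq_sq_iff_eq_or_eq_neg.mp h with h | h
  · exact h
  · rw [h, neg_re] at hx
    linarith

/-- A solution `(s, P, u)` of a Ramanujan-type differential system with the right behaviour at
`i∞` is parametrised by `₂F₁(1/4,1/4;1;s)`. -/
theorem exists_forall_eq_hyp2F1 {c : ℂ} {P u s : ℂ → ℂ}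
    (hs : ∀ z : ℂ, 0 < z.im → HasDerivAt s (c * (s z * P z)) z)
    (hP : ∀ᶠ z in comap Complex.im atTop,
      HasDerivAt P (c * ((P z ^ 2 - P z ^ 2 / (1 - s z)) / 2 + u z * P z / 3)) z)
    (hu : ∀ᶠ z in comap Complex.im atTop,
      HasDerivAt u (c * (3 / 8 * (P z ^ 2 / (1 - s z) - P z ^ 2) + u z ^ 2 / 6)) z)
    (hs0 : Tendsto s (comap Complex.im atTop) (𝓝 0))
    (hP1 : Tendsto P (comap Complex.im atTop) (𝓝 1))
    (hu0 : Tendsto u (comap Complex.im atTop) (𝓝 0)) :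
    ∃ Y : ℝ, 0 < Y ∧ ∀ z : ℂ, Y < z.im →
      P z = (1 - s z) ^ ((1 : ℂ) / 2) * hyp2F1 (1 / 4) (1 / 4) 1 (s z) ^ 2 := by
  set l := comap Complex.im atTop
  have hF0 : Tendsto (fun z ↦ hypTheta 0 (s z)) l (𝓝 1) := by
    simpa [hypTheta_zero_zero, Function.comp_def] using
      (continuousAt_hypTheta 0).tendsto.comp hs0
  have hF1 : Tendsto (fun z ↦ hypTheta 1 (s z)) l (𝓝 0) := by
    simpa [hypTheta_one_zero, Function.comp_def] using
      (continuousAt_hypTheta 1).tendsto.comp hs0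
  have h1s : Tendsto (fun z ↦ 1 - s z) l (𝓝 1) := by simpa using hs0.const_sub 1
  have hR : Tendsto (fun z ↦ (1 - s z) ^ ((1 : ℂ) / 2) * hypTheta 0 (s z) ^ 2) l (𝓝 1) := by
    simpa using (h1s.cpow tendsto_const_nhds (by simp)).mul (hF0.pow 2)
  have hre {f : ℂ → ℂ} (hf : Tendsto f l (𝓝 1)) : ∀ᶠ z in l, 0 < (f z).re :=
    (Complex.continuous_re.tendsto 1).comp hf |>.eventually (lt_mem_nhds (by simp))
  have hball : ∀ᶠ z in l, ‖s z‖ < 1 := hs0.norm.eventually (gt_mem_nhds (by simp))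
  have hev := hball.and <| (hre hP1).and <| (hre hR).and <| (hre h1s).and <| (hre hF0).and <|
    hP.and hu
  obtain ⟨Y, hY⟩ := (atTop_basis_Ioi.comap Complex.im).eventually_iff.mp hev
  simp only [true_and, Set.mem_preimage, Set.mem_Ioi] at hY
  replace hY : ∀ z : ℂ, max Y 1 < z.im → _ := fun z hz ↦ hY ((le_max_left _ _).trans_lt hz)
  have h0 {z : ℂ} (hz : max Y 1 < z.im) : 0 < z.im :=
    zero_lt_one.trans_le (le_max_right Y 1) |>.trans hz
  have hne {w : ℂ} (hw : 0 < w.re) : w ≠ 0 := by rintro rfl; simp at hw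
  have hdF (k : ℕ) (z : ℂ) (hz : max Y 1 < z.im) :
      HasDerivAt (fun z ↦ hypTheta k (s z)) (c * (P z * hypTheta (k + 1) (s z))) z := by
    obtain ⟨d, hd, hd'⟩ := exists_hasDerivAt_hypTheta k (hY z hz).1
    exact (hd.comp z (hs z (h0 hz))).congr_deriv (by rw [← hd']; ring)
  have hdQ (z : ℂ) (hz : max Y 1 < z.im) : HasDerivAt (fun z ↦ P z ^ 2 / (1 - s z))
      (c * (2 / 3 * u z * (P z ^ 2 / (1 - s z)))) z := by
    obtain ⟨-, -, -, h1, -, hP, -⟩ := hY z hz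
    have := hne h1
    convert! (hP.fun_pow 2).fun_div ((hs z (h0 hz)).const_sub 1) this using 1
    field_simp
    ring
  have hQ1 : Tendsto (fun z ↦ P z ^ 2 / (1 - s z)) l (𝓝 1) := by
    simpa [Pi.div_def] using (hP1.pow 2).div h1s one_ne_zero
  set W : ℂ → ℂ := fun z ↦ hypTheta 0 (s z) * u z - 6 * (P z * hypTheta 1 (s z)) with hW
  have hdW (z : ℂ) (hz : max Y 1 < z.im) : HasDerivAt W (c * (u z / 6 * W z)) z := by
    obtain ⟨hb, -, -, h1, -, hP, hu⟩ := hY z hz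
    have := hne h1
    convert! ((hdF 0 z hz).fun_mul hu).fun_sub ((hP.fun_mul (hdF 1 z hz)).const_mul 6) using 1
    have h2 : hypTheta (1 + 1) (s z) =
        s z * (hypTheta 1 (s z) / 2 + hypTheta 0 (s z) / 16) / (1 - s z) := by
      rw [← hypTheta_two hb]
      field_simp
    rw [h2]
    simp only [hW, zero_add]
    field_simp
    ring
  have hW0 : Tendsto W l (𝓝 0) := by
    simpa using (hF0.mul hu0).sub ((hP1.mul hF1).const_mul 6)
  have hWz {z : ℂ} (hz : max Y 1 < z.im) : W z = 0 := by
    have h : W z ^ 4 / (P z ^ 2 / (1 - s z)) = 0 := by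
      refine eq_of_deriv_eq_zero_of_tendsto (f := fun z ↦ W z ^ 4 / (P z ^ 2 / (1 - s z)))
        (fun w hw ↦ ?_) (by simpa [Pi.div_def] using (hW0.pow 4).div hQ1 one_ne_zero) hz
      obtain ⟨-, hP0, -, h1, -⟩ := hY w hw
      have := hne h1
      have := hne hP0
      convert! ((hdW w hw).fun_pow 4).fun_div (hdQ w hw) (by positivity) using 1
      field_simp
      ring
    obtain ⟨-, hP0, -, h1, -⟩ := hY z hz
    have := hne h1
    have := hne hP0
    simpa [this, hne h1] using h
  have hFQ {z : ℂ} (hz : max Y 1 < z.im) :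
      hypTheta 0 (s z) ^ 4 / (P z ^ 2 / (1 - s z)) = 1 := by
    refine eq_of_deriv_eq_zero_of_tendsto
      (f := fun z ↦ hypTheta 0 (s z) ^ 4 / (P z ^ 2 / (1 - s z)))
      (fun w hw ↦ ?_) (by simpa [Pi.div_def] using (hF0.pow 4).div hQ1 one_ne_zero) hz
    obtain ⟨-, hP0, -, h1, -⟩ := hY w hw
    have := hne h1
    have := hne hP0
    convert! ((hdF 0 w hw).fun_pow 4).fun_div (hdQ w hw) (by positivity) using 1
    have hw0 := hWz hw
    simp only [hW] at hw0
    field_simp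
    simp only [zero_add]
    linear_combination (2 * c * hypTheta 0 (s w) ^ 3 * (1 - s w)) * hw0
  refine ⟨max Y 1, zero_lt_one.trans_le (le_max_right _ _), fun z hz ↦ ?_⟩
  obtain ⟨-, hP0, hR0, h1, -⟩ := hY z hz
  rw [hyp2F1_eq_hypTheta]
  refine eq_of_sq_eq_sq_of_re_pos ?_ hP0 hR0
  have := hne h1
  have := hne hP0
  have h := hFQ hz
  rw [mul_pow, ← Complex.cpow_nat_mul]
  norm_num
  field_simp at h
  rw [← h]
  ring

open UpperHalfPlane hiding I
open ModularForm SlashInvariantForm ModularGroup Asymptotics CongruenceSubgroup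
open scoped Manifold MatrixGroups ModularForm

/-- A level one function of weight less than `12` vanishing at `i∞` is zero. -/
theorem eq_zero_of_weight_lt_twelve {k : ℤ} (hk : k < 12) {f : ℍ → ℂ} (hf : MDiff f)
    (hS : f ∣[k] S = f) (hT : f ∣[k] T = f) (h0 : IsZeroAtImInfty f) : f = 0 := by
  let F : CuspForm 𝒮ℒ k :=
    { toFun := f
      slash_action_eq' := by
        rintro _ ⟨A, rfl⟩
        exact slash_action_generators_SL2Z hS hT A
      holo' := hf
      zero_at_cusps' := fun hc ↦ by
        rw [Subgroup.IsArithmetic.isCusp_iff_isCusp_SL2Z] at hc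
        rw [OnePoint.isZeroAt_iff_forall_SL2Z hc]
        intro γ _
        rw [slash_action_generators_SL2Z hS hT]
        exact h0 }
  exact congrArg DFunLike.coe
    (rank_zero_iff_forall_zero.mp (CuspForm.rank_eq_zero_of_weight_lt_twelve hk) F)

/-- A level one function of weight less than `24` vanishing to order greater than `1` at `i∞`
is zero. -/
theorem eq_zero_of_weight_lt_twentyFour {k : ℤ} (hk : k < 24) {f : ℍ → ℂ} (hf : MDiff f)
    (hS : f ∣[k] S = f) (hT : f ∣[k] T = f)
    (h0 : f =o[atImInfty] fun τ ↦ Real.exp (-2 * Real.pi * τ.im)) : f = 0 := by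
  have key : f / discriminant = 0 := by
    refine eq_zero_of_weight_lt_twelve (k := k - 12) (by lia)
      (hf.div CuspForm.discriminant.holo' discriminant_ne_zero) ?_ ?_ ?_
    · rw [div_slash_SL2, hS, discriminant_S_invariant]
    · rw [div_slash_SL2, hT, discriminant_T_invariant]
    · exact (h0.trans_isBigO exp_isBigO_discriminant).tendsto_div_nhds_zero
  ext z
  simpa [discriminant_ne_zero] using congrFun key z

lemma slash_T_apply (k : ℤ) (f : ℍ → ℂ) (τ : ℍ) : (f ∣[k] T) τ = f ((1 : ℝ) +ᵥ τ) := by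
  rw [SL_slash_apply, modular_T_smul]
  simp [ModularGroup.denom_apply, coe_T]

lemma slash_S_slash_S {k : ℤ} (hk : Even k) (f : ℍ → ℂ) : (f ∣[k] S) ∣[k] S = f := by
  ext τ
  rw [slash_S_apply, slash_S_apply, mul_assoc, ← mul_zpow]
  simp [inv_neg, τ.ne_zero, hk.neg.neg_one_zpow]

/-- A holomorphic function of weight `k` on the group `Γ₀(2)`, bounded at the cusp `0` and vanishing
to order greater than `1` at `i∞`, is zero if `3 * k < 24`. -/
theorem eq_zero_of_slash_S_slash_T_sq {k : ℤ} (hk : k < 8) (heven : Even k) {f g : ℍ → ℂ}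
    (hf : MDiff f) (hg : MDiff g) (hfT : f ∣[k] T = f) (hfS : f ∣[k] S = g)
    (hgT : (g ∣[k] T) ∣[k] T = g) (hgb : IsBoundedAtImInfty g)
    (h0 : f =o[atImInfty] fun τ ↦ Real.exp (-2 * Real.pi * τ.im)) : f = 0 := by
  set h := g ∣[k] T with hh
  have hgS : g ∣[k] S = f := by rw [← hfS, slash_S_slash_S heven]
  have hhS : h ∣[k] S = h := by
    have hrel : S * T * S = T⁻¹ * S * T⁻¹ := by
      exact Subtype.ext (by simp [coe_S, coe_T])
    have hfT' : f ∣[k] T⁻¹ = f := by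
      conv_lhs => rw [← hfT, ← SlashAction.slash_mul]
      simp
    have hgT' : g ∣[k] T⁻¹ = h := by
      conv_lhs => rw [← hgT, ← SlashAction.slash_mul, mul_inv_cancel, SlashAction.slash_one]
    rw [hh, ← hfS, ← SlashAction.slash_mul, ← SlashAction.slash_mul, ← mul_assoc, hrel,
      SlashAction.slash_mul, SlashAction.slash_mul, hfT', hfS, hgT', hh]
  have hhd : MDiff h := hg.slash k _
  have hhb : IsBoundedAtImInfty h := by
    have : h = g ∘ (T • ·) := by
      ext τ
      rw [hh, slash_T_apply, Function.comp_apply, modular_T_smul]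
    rw [this]
    exact hgb.comp_tendsto (tendsto_smul_atImInfty (g := (T : GL (Fin 2) ℝ)) (by simp [coe_T]))
  have hN : f * (g * h) = 0 := by
    refine eq_zero_of_weight_lt_twentyFour (k := k + (k + k)) (by lia)
      (hf.mul (hg.mul hhd)) ?_ ?_ ?_
    · rw [mul_slash_SL2, mul_slash_SL2, hfS, hgS, hhS]
      ring
    · rw [mul_slash_SL2, mul_slash_SL2, hfT, hgT, ← hh]
      ring
    · simpa using! h0.mul_isBigO (hgb.mul hhb)
  rcases (UpperHalfPlane.mul_eq_zero_iff hf (hg.mul hhd)).mp hN with h | h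
  · exact h
  rcases (UpperHalfPlane.mul_eq_zero_iff hg hhd).mp h with h | h
  · rw [← hgS, h, SlashAction.zero_slash]
  · rw [← hgS, ← hgT, h, SlashAction.zero_slash, SlashAction.zero_slash]

open EisensteinSeries Derivative Function.Periodic

/-- A holomorphic function on the upper half-plane given by a `q`-expansion factors through an
analytic function of `q` at the origin. -/
theorem exists_analyticAt_eq_comp_qParam {F : ℍ → ℂ} {c : ℕ → ℂ} (hF : MDiff F)
    (hsum : ∀ τ : ℍ, HasSum (fun m ↦ c m • qParam 1 τ ^ m) (F τ)) :
    ∃ G : ℂ → ℂ, AnalyticAt ℂ G 0 ∧ G 0 = c 0 ∧ deriv G 0 = c 1 ∧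
      ∀ τ : ℍ, F τ = G (qParam 1 τ) := by
  have hper : Function.Periodic (F ∘ ofComplex) ((1 : ℝ) : ℂ) := by
    intro w
    by_cases! hw : 0 < w.im
    · have hw' : 0 < (w + (1 : ℝ)).im := by simp [hw]
      have hq : qParam 1 (w + (1 : ℝ)) = qParam 1 w := by simp [qParam, mul_add, exp_add]
      simp only [Function.comp_apply, ofComplex_apply_of_im_pos hw, ofComplex_apply_of_im_pos hw']
      have h1 := hsum ⟨_, hw'⟩
      simp only [hq] at h1
      exact h1.unique (hsum ⟨w, hw⟩)
    · have hw' : (w + (1 : ℝ)).im ≤ 0 := by simp [hw]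
      simp only [Function.comp_apply, ofComplex_apply_of_im_nonpos hw,
        ofComplex_apply_of_im_nonpos hw']
  have han : AnalyticAt ℂ (cuspFunction 1 F) 0 := analyticAt_cuspFunction_zero one_pos hper hF
    (isBoundedAtImInfty_of_hasSum_qExpansion one_pos hsum)
  have hser := (hasFPowerSeriesOnBall_cuspFunction one_pos han hsum).hasFPowerSeriesAt
  refine ⟨cuspFunction 1 F, han, ?_, ?_, fun τ ↦ (eq_cuspFunction τ one_ne_zero hper).symm⟩
  · rw [← hser.coeff_zero (fun _ ↦ 1)]
    simp
  · rw [hser.deriv]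
    simp

lemma isLittleO_comp_qParam {H : ℂ → ℂ} (h0 : H 0 = 0) (h1 : HasDerivAt H 0 0) :
    (fun τ : ℍ ↦ H (qParam 1 τ)) =o[atImInfty] fun τ ↦ Real.exp (-2 * Real.pi * τ.im) := by
  have h2 := h1.isLittleO
  simp only [h0, sub_zero, smul_zero] at h2
  refine (h2.comp_tendsto (qParam_tendsto_atImInfty one_pos)).congr' .rfl .rfl |>.trans_isBigO ?_
  refine .of_norm_le fun τ ↦ ?_
  simp [norm_qParam]

theorem isZeroAtImInfty_normalizedDerivOfComplex {F : ℍ → ℂ} {G : ℂ → ℂ} (hG : AnalyticAt ℂ G 0)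
    (hFG : ∀ τ : ℍ, F τ = G (qParam 1 τ)) : IsZeroAtImInfty (D F) := by
  have hlim := qParam_tendsto_atImInfty one_pos
  have h1 : Tendsto (fun τ : ℍ ↦ deriv G (qParam 1 τ) * qParam 1 τ) atImInfty (𝓝 0) := by
    simpa using (hG.deriv.continuousAt.tendsto.comp hlim).mul hlim
  refine h1.congr' ?_
  filter_upwards [hlim.eventually hG.eventually_analyticAt] with τ hτ
  have h2 : HasDerivAt (qParam 1) (2 * Real.pi * I * qParam 1 τ) τ := by
    have : HasDerivAt (fun z : ℂ ↦ 2 * Real.pi * I * z / (1 : ℝ)) (2 * Real.pi * I) τ := by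
      simpa using (hasDerivAt_id (τ : ℂ)).const_mul (2 * Real.pi * I)
    exact this.cexp.congr_deriv (by simp only [qParam, mul_comm])
  have h3 : F ∘ ofComplex =ᶠ[𝓝 (τ : ℂ)] G ∘ qParam 1 := by
    filter_upwards [isOpen_upperHalfPlaneSet.mem_nhds τ.im_pos] with w hw
    simp [ofComplex_apply_of_im_pos hw, hFG]
  rw [normalizedDerivOfComplex, h3.deriv_eq,
    (hτ.differentiableAt.hasDerivAt.comp (τ : ℂ) h2).deriv]
  field

lemma exists_E2_eq_comp_qParam : ∃ G : ℂ → ℂ, AnalyticAt ℂ G 0 ∧ G 0 = 1 ∧ deriv G 0 = -24 ∧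
    ∀ τ : ℍ, E2 τ = G (qParam 1 τ) := by
  obtain ⟨G, h1, h2, h3, h4⟩ := exists_analyticAt_eq_comp_qParam E2_mdifferentiable
    (c := fun m ↦ if m = 0 then 1 else -24 * ArithmeticFunction.sigma 1 m) fun τ ↦ by
      simpa only [qParam, ofReal_one, div_one] using hasSum_qExpansion_E2 (z := τ)
  exact ⟨G, h1, by simpa using h2, by simpa using h3, h4⟩

lemma exists_E₄_eq_comp_qParam : ∃ G : ℂ → ℂ, AnalyticAt ℂ G 0 ∧ G 0 = 1 ∧ deriv G 0 = 240 ∧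
    ∀ τ : ℍ, E₄ τ = G (qParam 1 τ) := by
  have := exists_analyticAt_eq_comp_qParam (ModularFormClass.holo E₄)
    (ModularForm.hasSum_qExpansion E₄ one_pos one_mem_strictPeriods_SL)
  rwa [E_qExpansion_coeff_zero _ ⟨2, rfl⟩, E₄_qExpansion_coeff_one] at this

lemma exists_E₆_eq_comp_qParam : ∃ G : ℂ → ℂ, AnalyticAt ℂ G 0 ∧ G 0 = 1 ∧ deriv G 0 = -504 ∧
    ∀ τ : ℍ, E₆ τ = G (qParam 1 τ) := by
  have := exists_analyticAt_eq_comp_qParam (ModularFormClass.holo E₆)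
    (ModularForm.hasSum_qExpansion E₆ one_pos one_mem_strictPeriods_SL)
  rwa [E_qExpansion_coeff_zero _ ⟨3, rfl⟩, E₆_qExpansion_coeff_one] at this

lemma tendsto_E2_atImInfty : Tendsto E2 atImInfty (𝓝 1) := by
  obtain ⟨G, hG, hG0, -, hGE⟩ := exists_E2_eq_comp_qParam
  rw [← hG0, funext hGE]
  exact hG.continuousAt.tendsto.comp (qParam_tendsto_atImInfty one_pos)

lemma tendsto_E₄_atImInfty : Tendsto E₄ atImInfty (𝓝 1) := by
  obtain ⟨G, hG, hG0, -, hGE⟩ := exists_E₄_eq_comp_qParam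
  rw [← hG0, funext hGE]
  exact hG.continuousAt.tendsto.comp (qParam_tendsto_atImInfty one_pos)

lemma tendsto_E₆_atImInfty : Tendsto E₆ atImInfty (𝓝 1) := by
  obtain ⟨G, hG, hG0, -, hGE⟩ := exists_E₆_eq_comp_qParam
  rw [← hG0, funext hGE]
  exact hG.continuousAt.tendsto.comp (qParam_tendsto_atImInfty one_pos)

lemma E2_slash_S : E2 ∣[(2 : ℤ)] S = E2 + (6 / (Real.pi * I) : ℂ) • fun z : ℍ ↦ (z : ℂ)⁻¹ := by
  rw [E2_slash_action]
  ext z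
  have hpi : (Real.pi : ℂ) ≠ 0 := mod_cast Real.pi_ne_zero
  simp only [Pi.sub_apply, Pi.add_apply, Pi.smul_apply, smul_eq_mul, D2_S, riemannZeta_two]
  field_simp [z.ne_zero]
  linear_combination (-6) * I_sq

lemma E2_slash_T : E2 ∣[(2 : ℤ)] T = E2 := by
  rw [E2_slash_action, D2_T, smul_zero, sub_zero]

lemma mdifferentiable_coe_inv : MDiff (fun z : ℍ ↦ (z : ℂ)⁻¹) := by
  rw [UpperHalfPlane.mdifferentiable_iff]
  refine DifferentiableOn.congr (f := fun z ↦ z⁻¹) (fun z hz ↦ ?_) fun z hz ↦ by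
    simp [ofComplex_apply_of_im_pos hz]
  exact (differentiableAt_inv (fun h ↦ by simp [h] at hz)).differentiableWithinAt

lemma normalizedDerivOfComplex_coe_inv (z : ℍ) :
    D (fun z : ℍ ↦ (z : ℂ)⁻¹) z = -(2 * Real.pi * I)⁻¹ * ((z : ℂ) ^ 2)⁻¹ := by
  have h : (fun z : ℍ ↦ (z : ℂ)⁻¹) ∘ ofComplex =ᶠ[𝓝 (z : ℂ)] fun w ↦ w⁻¹ := by
    filter_upwards [isOpen_upperHalfPlaneSet.mem_nhds z.im_pos] with w hw
    simp [ofComplex_apply_of_im_pos hw]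
  rw [normalizedDerivOfComplex, h.deriv_eq, deriv_inv]
  ring

lemma E₄_slash (γ : SL(2, ℤ)) : (E₄ : ℍ → ℂ) ∣[(4 : ℤ)] γ = E₄ :=
  SlashInvariantForm.slash_action_eqn E₄ _ ⟨γ, rfl⟩

lemma E₆_slash (γ : SL(2, ℤ)) : (E₆ : ℍ → ℂ) ∣[(6 : ℤ)] γ = E₆ :=
  SlashInvariantForm.slash_action_eqn E₆ _ ⟨γ, rfl⟩

/-- Ramanujan's differential equation for `E2`. -/
theorem normalizedDerivOfComplex_E2 (τ : ℍ) : D E2 τ = (E2 τ ^ 2 - E₄ τ) / 12 := by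
  have hpi : (Real.pi : ℂ) ≠ 0 := mod_cast Real.pi_ne_zero
  set f : ℍ → ℂ := D E2 - (12 : ℂ)⁻¹ • (E2 * E2 - E₄) with hf
  suffices f = 0 by
    have := congrFun this τ
    simp only [hf, Pi.sub_apply, Pi.smul_apply, Pi.mul_apply, smul_eq_mul, Pi.zero_apply] at this
    linear_combination this
  have hslash (γ : SL(2, ℤ)) : f ∣[(4 : ℤ)] γ =
      D E2 ∣[(4 : ℤ)] γ - (12 : ℂ)⁻¹ • ((E2 ∣[(2 : ℤ)] γ) * (E2 ∣[(2 : ℤ)] γ) - E₄) := by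
    rw [hf, sub_eq_add_neg, SlashAction.add_slash, SlashAction.neg_slash, SL_smul_slash,
      sub_eq_add_neg, SlashAction.add_slash, SlashAction.neg_slash, E₄_slash, ← mul_slash_SL2 2 2]
    rfl
  have hD (γ : SL(2, ℤ)) : D (E2 ∣[(2 : ℤ)] γ) = D E2 ∣[(4 : ℤ)] γ - _ :=
    normalizedDerivOfComplex_SL_slash E2_mdifferentiable
  obtain ⟨G, hG, -, -, hGE⟩ := exists_E2_eq_comp_qParam
  refine eq_zero_of_weight_lt_twelve (k := 4) (by norm_num) ?_ ?_ ?_ ?_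
  · exact (normalizedDerivOfComplex_mdifferentiable E2_mdifferentiable).sub
      (((E2_mdifferentiable.mul E2_mdifferentiable).sub (ModularFormClass.holo E₄)).const_smul _)
  · rw [hslash]
    ext z
    have hzi := z.ne_zero
    have h := congrFun (hD S) z
    have hadd : D (E2 ∣[(2 : ℤ)] S) z =
        D E2 z + 6 / (Real.pi * I) * (-(2 * Real.pi * I)⁻¹ * ((z : ℂ) ^ 2)⁻¹) := by
      rw [E2_slash_S, normalizedDerivOfComplex_add _ _ E2_mdifferentiable
        (mdifferentiable_coe_inv.const_smul (6 / (Real.pi * I))),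
        normalizedDerivOfComplex_smul _ _ mdifferentiable_coe_inv, Pi.add_apply, Pi.smul_apply,
        normalizedDerivOfComplex_coe_inv, smul_eq_mul]
    rw [hadd, Pi.sub_apply] at h
    simp only [E2_slash_S, Pi.sub_apply, Pi.smul_apply, Pi.mul_apply, Pi.add_apply, smul_eq_mul,
      hf, ModularGroup.denom_apply, coe_S] at h ⊢
    rw [eq_comm, sub_eq_iff_eq_add] at h
    rw [h]
    simp
    field_simp
    linear_combination (-72 - 24 * I * Real.pi * z * E2 z) * I_sq
  · rw [hslash]
    have h : D E2 = D E2 ∣[(4 : ℤ)] T := by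
      conv_lhs => rw [← E2_slash_T, hD T]
      ext z
      simp [coe_T]
    rw [E2_slash_T, ← h]
  · have := (isZeroAtImInfty_normalizedDerivOfComplex hG hGE).sub
      (((tendsto_E2_atImInfty.mul tendsto_E2_atImInfty).sub tendsto_E₄_atImInfty).const_smul
        (12 : ℂ)⁻¹)
    rw [mul_one, sub_self, smul_zero, sub_zero] at this
    exact this

/-- The point `2 * τ` of the upper half-plane. -/
noncomputable def double (τ : ℍ) : ℍ := (⟨2, two_pos⟩ : {x : ℝ // 0 < x}) • τ

/-- The point `τ / 2` of the upper half-plane. -/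
noncomputable def half (τ : ℍ) : ℍ := (⟨1 / 2, one_half_pos⟩ : {x : ℝ // 0 < x}) • τ

@[simp]
lemma coe_double (τ : ℍ) : (double τ : ℂ) = 2 * τ := by simp [double]

@[simp]
lemma coe_half (τ : ℍ) : (half τ : ℂ) = τ / 2 := by simp [half]; ring

@[simp]
lemma double_half (τ : ℍ) : double (half τ) = τ := UpperHalfPlane.ext (by simp; ring)

@[simp]
lemma half_double (τ : ℍ) : half (double τ) = τ := UpperHalfPlane.ext (by simp)

lemma double_one_vadd (τ : ℍ) : double ((1 : ℝ) +ᵥ τ) = (1 : ℝ) +ᵥ ((1 : ℝ) +ᵥ double τ) :=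
  UpperHalfPlane.ext (by simp; ring)

lemma half_one_vadd_one_vadd (τ : ℍ) :
    half ((1 : ℝ) +ᵥ ((1 : ℝ) +ᵥ τ)) = (1 : ℝ) +ᵥ half τ :=
  UpperHalfPlane.ext (by simp; ring)

lemma double_S_smul (τ : ℍ) : double (S • τ) = S • half τ :=
  UpperHalfPlane.ext (by simp only [modular_S_smul, coe_double, coe_half]; field [τ.ne_zero])

lemma half_S_smul (τ : ℍ) : half (S • τ) = S • double τ :=
  UpperHalfPlane.ext (by simp only [modular_S_smul, coe_double, coe_half]; field [τ.ne_zero])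

lemma mdifferentiable_pos_smul {f : ℍ → ℂ} (hf : MDiff f) (r : {x : ℝ // 0 < x}) :
    MDiff (fun τ ↦ f (r • τ)) := by
  rw [UpperHalfPlane.mdifferentiable_iff] at hf ⊢
  have h : Set.MapsTo (fun z : ℂ ↦ (r : ℝ) * z) upperHalfPlaneSet upperHalfPlaneSet :=
    fun z hz ↦ by simpa using mul_pos r.2 hz
  refine (hf.comp (by fun_prop) h).congr fun z hz ↦ ?_
  simp only [Function.comp_apply, ofComplex_apply_of_im_pos hz, ofComplex_apply_of_im_pos (h hz)]
  congr 1

lemma mdifferentiable_comp_double {f : ℍ → ℂ} (hf : MDiff f) : MDiff (fun τ ↦ f (double τ)) :=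
  mdifferentiable_pos_smul hf _

lemma mdifferentiable_comp_half {f : ℍ → ℂ} (hf : MDiff f) : MDiff (fun τ ↦ f (half τ)) :=
  mdifferentiable_pos_smul hf _

lemma tendsto_double_atImInfty : Tendsto double atImInfty atImInfty :=
  tendsto_comap_iff.mpr <| (tendsto_comap.const_mul_atTop two_pos).congr fun τ ↦ by
    simp [double]

lemma tendsto_half_atImInfty : Tendsto half atImInfty atImInfty :=
  tendsto_comap_iff.mpr <| (tendsto_comap.const_mul_atTop one_half_pos).congr fun τ ↦ by
    simp [half]

lemma qParam_double (τ : ℍ) : qParam 1 (double τ) = qParam 1 τ ^ 2 := by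
  rw [qParam, qParam, ← Complex.exp_nat_mul]
  simp
  ring_nf

lemma apply_S_smul {k : ℕ} {f g : ℍ → ℂ} (h : f ∣[(k : ℤ)] S = g) (τ : ℍ) :
    f (S • τ) = (τ : ℂ) ^ k * g τ := by
  rw [← h, SL_slash_apply, ModularGroup.denom_apply]
  simp [coe_S, mul_comm (f _), τ.ne_zero]

lemma apply_one_vadd {k : ℤ} {f g : ℍ → ℂ} (h : f ∣[k] T = g) (τ : ℍ) :
    f ((1 : ℝ) +ᵥ τ) = g τ := by
  rw [← h, slash_T_apply]

lemma slash_S_eq {k : ℕ} {f g : ℍ → ℂ} (h : ∀ τ, f (S • τ) = (τ : ℂ) ^ k * g τ) :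
    f ∣[(k : ℤ)] S = g := by
  ext τ
  rw [SL_slash_apply, ModularGroup.denom_apply, h]
  simp [coe_S, mul_comm _ (g τ), τ.ne_zero]

lemma E2_S_smul (τ : ℍ) : E2 (S • τ) = τ ^ 2 * (E2 τ + 6 / (Real.pi * I) * (τ : ℂ)⁻¹) :=
  apply_S_smul (k := 2) E2_slash_S τ

lemma E₄_S_smul (τ : ℍ) : E₄ (S • τ) = τ ^ 4 * E₄ τ :=
  apply_S_smul (k := 4) (E₄_slash S) τ

lemma E₆_S_smul (τ : ℍ) : E₆ (S • τ) = τ ^ 6 * E₆ τ :=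
  apply_S_smul (k := 6) (E₆_slash S) τ

lemma E2_one_vadd (τ : ℍ) : E2 ((1 : ℝ) +ᵥ τ) = E2 τ := apply_one_vadd E2_slash_T τ

lemma E₄_one_vadd (τ : ℍ) : E₄ ((1 : ℝ) +ᵥ τ) = E₄ τ := apply_one_vadd (E₄_slash T) τ

lemma E₆_one_vadd (τ : ℍ) : E₆ ((1 : ℝ) +ᵥ τ) = E₆ τ := apply_one_vadd (E₆_slash T) τ

/-- The weight two Eisenstein series `2 * E2 (2 * τ) - E2 τ` of level `Γ₀(2)`. -/
noncomputable def E2Two (τ : ℍ) : ℂ := 2 * E2 (double τ) - E2 τ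

lemma mdifferentiable_E2Two : MDiff E2Two :=
  ((mdifferentiable_comp_double E2_mdifferentiable).const_smul (2 : ℂ)).sub E2_mdifferentiable

lemma tendsto_E2Two_atImInfty : Tendsto E2Two atImInfty (𝓝 1) := by
  have := ((tendsto_E2_atImInfty.comp tendsto_double_atImInfty).const_mul 2).sub
    tendsto_E2_atImInfty
  rw [mul_one, show (2 : ℂ) - 1 = 1 by norm_num] at this
  exact this

lemma E2Two_S_smul (τ : ℍ) : E2Two (S • τ) = -(τ ^ 2 / 2) * E2Two (half τ) := by
  simp only [E2Two, double_S_smul, E2_S_smul, coe_half, double_half]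
  field [τ.ne_zero]

lemma E2Two_one_vadd (τ : ℍ) : E2Two ((1 : ℝ) +ᵥ τ) = E2Two τ := by
  simp only [E2Two, double_one_vadd, E2_one_vadd]

lemma hasDerivAt_comp_sq_zero {G : ℂ → ℂ} (hG : AnalyticAt ℂ G 0) :
    HasDerivAt (fun x ↦ G (x ^ 2)) 0 0 := by
  have h : HasDerivAt G (deriv G 0) ((0 : ℂ) ^ 2) := by
    simpa using hG.differentiableAt.hasDerivAt
  exact (h.comp (0 : ℂ) (hasDerivAt_pow 2 (0 : ℂ))).congr_deriv (by simp)

theorem five_mul_E2Two_sq (τ : ℍ) : 5 * E2Two τ ^ 2 = E₄ τ + 4 * E₄ (double τ) := by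
  obtain ⟨G, hG, hG0, hG1, hGE⟩ := exists_E2_eq_comp_qParam
  obtain ⟨K, hK, hK0, hK1, hKE⟩ := exists_E₄_eq_comp_qParam
  have hP := mdifferentiable_E2Two
  have hE := ModularFormClass.holo E₄
  have key := eq_zero_of_slash_S_slash_T_sq (k := 4) (by norm_num) ⟨2, rfl⟩
    (f := fun τ ↦ 5 * E2Two τ ^ 2 - E₄ τ - 4 * E₄ (double τ))
    (g := fun τ ↦ 5 / 4 * E2Two (half τ) ^ 2 - E₄ τ - 1 / 4 * E₄ (half τ))
    ?_ ?_ ?_ ?_ ?_ ?_ ?_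
  · have := congrFun key τ
    simp only [Pi.zero_apply] at this
    linear_combination this
  · exact ((((hP.pow 2).const_smul (5 : ℂ)).sub hE).sub
      ((mdifferentiable_comp_double hE).const_smul (4 : ℂ)))
  · exact (((((mdifferentiable_comp_half hP).pow 2).const_smul (5 / 4 : ℂ)).sub hE).sub
      ((mdifferentiable_comp_half hE).const_smul (1 / 4 : ℂ)))
  · ext τ
    simp only [slash_T_apply, E2Two_one_vadd, E₄_one_vadd, double_one_vadd]
  · refine slash_S_eq (k := 4) fun τ ↦ ?_
    simp only [E2Two_S_smul, E₄_S_smul, double_S_smul, coe_half]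
    ring
  · ext τ
    simp only [slash_T_apply, E2Two_one_vadd, E₄_one_vadd, half_one_vadd_one_vadd]
  · exact (((((tendsto_E2Two_atImInfty.comp tendsto_half_atImInfty).pow 2).const_mul (5 / 4)).sub
      tendsto_E₄_atImInfty).sub
      ((tendsto_E₄_atImInfty.comp tendsto_half_atImInfty).const_mul (1 / 4))).isBigO_one ℝ
  · simp only [E2Two, hGE, hKE, qParam_double]
    refine isLittleO_comp_qParam
      (H := fun x ↦ 5 * (2 * G (x ^ 2) - G x) ^ 2 - K x - 4 * K (x ^ 2)) ?_ ?_
    · norm_num [hG0, hK0]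
    · have h1 := (((((hasDerivAt_comp_sq_zero hG).const_mul 2).sub
        hG.differentiableAt.hasDerivAt).pow 2).const_mul 5).sub hK.differentiableAt.hasDerivAt
      refine (h1.sub ((hasDerivAt_comp_sq_zero hK).const_mul 4)).congr_deriv ?_
      norm_num [hG0, hG1, hK1]

theorem five_mul_E₆ (τ : ℍ) : 5 * E₆ τ = E2Two τ * (16 * E₄ (double τ) - 11 * E₄ τ) := by
  obtain ⟨G, hG, hG0, hG1, hGE⟩ := exists_E2_eq_comp_qParam
  obtain ⟨K, hK, hK0, hK1, hKE⟩ := exists_E₄_eq_comp_qParam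
  obtain ⟨L, hL, hL0, hL1, hLE⟩ := exists_E₆_eq_comp_qParam
  have hP := mdifferentiable_E2Two
  have hE := ModularFormClass.holo E₄
  have hF := ModularFormClass.holo E₆
  have key := eq_zero_of_slash_S_slash_T_sq (k := 6) (by norm_num) ⟨3, rfl⟩
    (f := fun τ ↦ 5 * E₆ τ - E2Two τ * (16 * E₄ (double τ) - 11 * E₄ τ))
    (g := fun τ ↦ 5 * E₆ τ + 1 / 2 * (E2Two (half τ) * (E₄ (half τ) - 11 * E₄ τ)))
    ?_ ?_ ?_ ?_ ?_ ?_ ?_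
  · have := congrFun key τ
    simp only [Pi.zero_apply] at this
    linear_combination this
  · exact (hF.const_smul (5 : ℂ)).sub (hP.mul
      (((mdifferentiable_comp_double hE).const_smul (16 : ℂ)).sub (hE.const_smul (11 : ℂ))))
  · exact (hF.const_smul (5 : ℂ)).add (((mdifferentiable_comp_half hP).mul
      ((mdifferentiable_comp_half hE).sub (hE.const_smul (11 : ℂ)))).const_smul (1 / 2 : ℂ))
  · ext τ
    simp only [slash_T_apply, E2Two_one_vadd, E₄_one_vadd, E₆_one_vadd, double_one_vadd]
  · refine slash_S_eq (k := 6) fun τ ↦ ?_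
    simp only [E2Two_S_smul, E₄_S_smul, E₆_S_smul, double_S_smul, coe_half]
    ring
  · ext τ
    simp only [slash_T_apply, E2Two_one_vadd, E₄_one_vadd, E₆_one_vadd, half_one_vadd_one_vadd]
  · exact ((tendsto_E₆_atImInfty.const_mul 5).add
      (((tendsto_E2Two_atImInfty.comp tendsto_half_atImInfty).mul
        ((tendsto_E₄_atImInfty.comp tendsto_half_atImInfty).sub
          (tendsto_E₄_atImInfty.const_mul 11))).const_mul (1 / 2))).isBigO_one ℝ
  · simp only [E2Two, hGE, hKE, hLE, qParam_double]
    refine isLittleO_comp_qParam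
      (H := fun x ↦ 5 * L x - (2 * G (x ^ 2) - G x) * (16 * K (x ^ 2) - 11 * K x)) ?_ ?_
    · norm_num [hG0, hK0, hL0]
    · have h1 := (((hasDerivAt_comp_sq_zero hG).const_mul 2).sub
        hG.differentiableAt.hasDerivAt).mul (((hasDerivAt_comp_sq_zero hK).const_mul 16).sub
          (hK.differentiableAt.hasDerivAt.const_mul 11))
      refine ((hL.differentiableAt.hasDerivAt.const_mul 5).sub h1).congr_deriv ?_
      norm_num [hG0, hG1, hK0, hK1, hL1]

theorem ten_mul_E₆_double (τ : ℍ) :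
    10 * E₆ (double τ) = E2Two τ * (11 * E₄ (double τ) - E₄ τ) := by
  have h := five_mul_E₆ (half (S • τ))
  rw [double_half, half_S_smul, E2Two_S_smul, half_double, E₄_S_smul, E₄_S_smul, E₆_S_smul,
    coe_double] at h
  have hτ : (τ : ℂ) ^ 6 ≠ 0 := pow_ne_zero _ τ.ne_zero
  refine mul_left_cancel₀ hτ ?_
  linear_combination h / 32

lemma hasDerivAt_comp_ofComplex {F : ℍ → ℂ} (hF : MDiff F) (τ : ℍ) :
    HasDerivAt (F ∘ ofComplex) (2 * Real.pi * I * D F τ) τ := by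
  refine (mdifferentiableAt_iff.mp (hF τ)).hasDerivAt.congr_deriv ?_
  rw [normalizedDerivOfComplex, mul_inv_cancel_left₀ two_pi_I_ne_zero]

lemma normalizedDerivOfComplex_comp_double {F : ℍ → ℂ} (hF : MDiff F) (τ : ℍ) :
    D (fun τ ↦ F (double τ)) τ = 2 * D F (double τ) := by
  have h : (fun τ ↦ F (double τ)) ∘ ofComplex =ᶠ[𝓝 (τ : ℂ)] (F ∘ ofComplex) ∘ (2 * ·) := by
    filter_upwards [isOpen_upperHalfPlaneSet.mem_nhds τ.im_pos] with w hw
    have hw' : 0 < (2 * w).im := by simpa using hw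
    simp only [Function.comp_apply, ofComplex_apply_of_im_pos hw, ofComplex_apply_of_im_pos hw']
    exact congrArg F (UpperHalfPlane.ext (coe_double _))
  have h1 := hasDerivAt_comp_ofComplex hF (double τ)
  rw [coe_double] at h1
  rw [normalizedDerivOfComplex, h.deriv_eq,
    (h1.comp (τ : ℂ) ((hasDerivAt_id (τ : ℂ)).const_mul 2)).deriv]
  field [two_pi_I_ne_zero]

lemma mdifferentiable_discriminant : MDiff discriminant := CuspForm.discriminant.holo'

lemma normalizedDerivOfComplex_discriminant (τ : ℍ) :
    D discriminant τ = E2 τ * discriminant τ := by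
  have h : discriminant ∘ ofComplex =ᶠ[𝓝 (τ : ℂ)] ModularForm.eta ^ 24 := by
    filter_upwards [isOpen_upperHalfPlaneSet.mem_nhds τ.im_pos] with w hw
    simp [discriminant, ofComplex_apply_of_im_pos hw]
  have h1 := logDeriv_eta_eq_E2 τ
  rw [logDeriv_apply, div_eq_iff (eta_ne_zero τ.im_pos)] at h1
  rw [normalizedDerivOfComplex, h.deriv_eq,
    ((differentiableAt_eta_of_mem_upperHalfPlaneSet τ.im_pos).hasDerivAt.pow 24).deriv, h1,
    discriminant]
  push_cast
  field

/-- The modular function `-64 * Δ (2 * τ) / Δ τ` of level `Γ₀(2)`. -/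
noncomputable def hauptmodul (τ : ℍ) : ℂ := -64 * discriminant (double τ) / discriminant τ

/-- The difference `E2 τ - E2 (2 * τ)`. -/
noncomputable def E2Diff (τ : ℍ) : ℂ := E2 τ - E2 (double τ)

lemma mdifferentiable_E2Diff : MDiff E2Diff :=
  E2_mdifferentiable.sub (mdifferentiable_comp_double E2_mdifferentiable)

lemma mdifferentiable_hauptmodul : MDiff hauptmodul :=
  ((mdifferentiable_comp_double mdifferentiable_discriminant).const_smul (-64 : ℂ)).div
    mdifferentiable_discriminant discriminant_ne_zero

theorem normalizedDerivOfComplex_hauptmodul (τ : ℍ) :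
    D hauptmodul τ = hauptmodul τ * E2Two τ := by
  have hmul : hauptmodul * discriminant = (-64 : ℂ) • fun τ ↦ discriminant (double τ) := by
    ext τ
    simp [hauptmodul, discriminant_ne_zero]
  have h := congrFun (congrArg D hmul) τ
  rw [normalizedDerivOfComplex_mul _ _ mdifferentiable_hauptmodul mdifferentiable_discriminant,
    normalizedDerivOfComplex_smul _ _ (mdifferentiable_comp_double mdifferentiable_discriminant)]
    at h
  have hτ := congrFun hmul τ
  simp only [Pi.add_apply, Pi.mul_apply, Pi.smul_apply, smul_eq_mul,
    normalizedDerivOfComplex_comp_double mdifferentiable_discriminant,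
    normalizedDerivOfComplex_discriminant] at h hτ
  refine mul_right_cancel₀ (discriminant_ne_zero τ) ?_
  rw [E2Two]
  linear_combination h - 2 * E2 (double τ) * hτ

lemma E2Two_sq_eq (τ : ℍ) :
    E2Two τ ^ 2 = (1 - hauptmodul τ) * ((16 * E₄ (double τ) - E₄ τ) / 15) := by
  set Q := (16 * E₄ (double τ) - E₄ τ) / 15 with hQ
  have ha := five_mul_E2Two_sq τ
  have hb := five_mul_E₆ τ
  have hc := ten_mul_E₆_double τ
  have h4 : E₄ τ = 4 * E2Two τ ^ 2 - 3 * Q := by linear_combination (-4 / 5) * ha - 3 * hQ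
  have h4' : E₄ (double τ) = (E2Two τ ^ 2 + 3 * Q) / 4 := by
    linear_combination (-1 / 20) * ha - 3 / 4 * hQ
  have h6 : E₆ τ = E2Two τ * (9 * Q - 8 * E2Two τ ^ 2) := by
    rw [h4, h4'] at hb
    linear_combination hb / 5
  have h6' : E₆ (double τ) = E2Two τ * (9 * Q - E2Two τ ^ 2) / 8 := by
    rw [h4, h4'] at hc
    linear_combination hc / 10
  have hd : discriminant τ = Q ^ 2 * (E2Two τ ^ 2 - Q) / 64 := by
    rw [discriminant_eq_E₄_cube_sub_E₆_sq, h4, h6]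
    ring
  have hd' : discriminant (double τ) = Q * (E2Two τ ^ 2 - Q) ^ 2 / 4096 := by
    rw [discriminant_eq_E₄_cube_sub_E₆_sq, h4', h6']
    ring
  have hs : hauptmodul τ * discriminant τ = -64 * discriminant (double τ) :=
    div_mul_cancel₀ _ (discriminant_ne_zero τ)
  refine mul_left_cancel₀ (discriminant_ne_zero τ) ?_
  linear_combination Q * hs + (E2Two τ ^ 2 - Q) * hd - 64 * Q * hd'

lemma tendsto_hauptmodul_atImInfty : Tendsto hauptmodul atImInfty (𝓝 0) := by
  have hQ : Tendsto (fun τ ↦ (16 * E₄ (double τ) - E₄ τ) / 15) atImInfty (𝓝 1) := by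
    have := (((tendsto_E₄_atImInfty.comp tendsto_double_atImInfty).const_mul 16).sub
      tendsto_E₄_atImInfty).div_const 15
    rwa [show ((16 : ℂ) * 1 - 1) / 15 = 1 by norm_num] at this
  have h := ((tendsto_E2Two_atImInfty.pow 2).div hQ one_ne_zero).const_sub 1
  rw [one_pow, div_one, sub_self] at h
  refine h.congr' ?_
  filter_upwards [hQ.eventually_ne one_ne_zero] with τ hτ
  simp only [Pi.div_apply]
  rw [E2Two_sq_eq, mul_div_cancel_right₀ _ hτ, sub_sub_cancel]

lemma tendsto_E2Diff_atImInfty : Tendsto E2Diff atImInfty (𝓝 0) := by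
  have h := tendsto_E2_atImInfty.sub (tendsto_E2_atImInfty.comp tendsto_double_atImInfty)
  rwa [sub_self] at h

theorem normalizedDerivOfComplex_E2Two {τ : ℍ} (hτ : 1 - hauptmodul τ ≠ 0) :
    D E2Two τ = (E2Two τ ^ 2 - E2Two τ ^ 2 / (1 - hauptmodul τ)) / 2 +
      E2Diff τ * E2Two τ / 3 := by
  have h : E2Two = (2 : ℂ) • (fun τ ↦ E2 (double τ)) - E2 := rfl
  rw [h, normalizedDerivOfComplex_sub _ _
    ((mdifferentiable_comp_double E2_mdifferentiable).const_smul _) E2_mdifferentiable,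
    normalizedDerivOfComplex_smul _ _ (mdifferentiable_comp_double E2_mdifferentiable), ← h,
    Pi.sub_apply, Pi.smul_apply, normalizedDerivOfComplex_comp_double E2_mdifferentiable,
    normalizedDerivOfComplex_E2, normalizedDerivOfComplex_E2]
  have ha := five_mul_E2Two_sq τ
  have hQ : E2Two τ ^ 2 / (1 - hauptmodul τ) = (16 * E₄ (double τ) - E₄ τ) / 15 := by
    rw [E2Two_sq_eq, mul_div_cancel_left₀ _ hτ]
  rw [hQ]
  simp only [E2Diff, E2Two, smul_eq_mul] at ha ⊢
  linear_combination (-1 / 20) * ha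

theorem normalizedDerivOfComplex_E2Diff {τ : ℍ} (hτ : 1 - hauptmodul τ ≠ 0) :
    D E2Diff τ = 3 / 8 * (E2Two τ ^ 2 / (1 - hauptmodul τ) - E2Two τ ^ 2) +
      E2Diff τ ^ 2 / 6 := by
  have h : E2Diff = E2 - (fun τ ↦ E2 (double τ)) := rfl
  rw [h, normalizedDerivOfComplex_sub _ _ E2_mdifferentiable
    (mdifferentiable_comp_double E2_mdifferentiable), ← h,
    Pi.sub_apply, normalizedDerivOfComplex_comp_double E2_mdifferentiable,
    normalizedDerivOfComplex_E2, normalizedDerivOfComplex_E2]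
  have ha := five_mul_E2Two_sq τ
  have hQ : E2Two τ ^ 2 / (1 - hauptmodul τ) = (16 * E₄ (double τ) - E₄ τ) / 15 := by
    rw [E2Two_sq_eq, mul_div_cancel_left₀ _ hτ]
  rw [hQ]
  simp only [E2Diff, E2Two] at ha ⊢
  linear_combination (7 / 120) * ha

lemma Eis2_coe (τ : ℍ) : Eis2 τ = E2 τ := by
  have hq : ‖cexp (2 * Real.pi * I * τ)‖ < 1 := norm_exp_two_pi_I_lt_one τ
  rw [E2_eq_tsum_cexp, ← tsum_pow_div_one_sub_eq_tsum_sigma hq,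
    tsum_pnat_eq_tsum_succ (f := fun n ↦ (n : ℂ) ^ 1 * cexp (2 * Real.pi * I * τ) ^ n /
      (1 - cexp (2 * Real.pi * I * τ) ^ n))]
  simp [Eis2, qpar]

lemma dedekindEta_pow_coe (τ : ℍ) : dedekindEta τ ^ 24 = discriminant τ := by
  simp [discriminant, ModularForm.eta, dedekindEta, eta_q_eq_pow, qpar, qParam]

theorem stmt11 :
    ∃ Y : ℝ, 0 < Y ∧ ∀ τ : ℂ, Y < τ.im →
      2 * Eis2 (2 * τ) - Eis2 τ
        = (1 - (-64 * dedekindEta (2 * τ) ^ 24 / dedekindEta τ ^ 24)) ^ ((1 : ℂ) / 2) *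
          (hyp2F1 (1/4) (1/4) 1 (-64 * dedekindEta (2 * τ) ^ 24 / dedekindEta τ ^ 24)) ^ 2 := by
  have hne : ∀ᶠ z in comap Complex.im atTop, 0 < z.im ∧ 1 - hauptmodul (ofComplex z) ≠ 0 := by
    refine (tendsto_comap.eventually_gt_atTop 0).and ?_
    have h := (tendsto_hauptmodul_atImInfty.comp tendsto_comap_im_ofComplex).const_sub 1
    exact h.eventually_ne (by simp)
  have key := exists_forall_eq_hyp2F1 (c := 2 * Real.pi * I)
    (P := E2Two ∘ ofComplex) (u := E2Diff ∘ ofComplex) (s := hauptmodul ∘ ofComplex) ?_ ?_ ?_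
    (tendsto_hauptmodul_atImInfty.comp tendsto_comap_im_ofComplex)
    (tendsto_E2Two_atImInfty.comp tendsto_comap_im_ofComplex)
    (tendsto_E2Diff_atImInfty.comp tendsto_comap_im_ofComplex)
  · obtain ⟨Y, hY, h⟩ := key
    refine ⟨Y, hY, fun z hz ↦ ?_⟩
    lift z to ℍ using hY.trans hz
    rw [← coe_double, Eis2_coe, Eis2_coe, dedekindEta_pow_coe, dedekindEta_pow_coe]
    have hz' := h z hz
    rw [Function.comp_apply, Function.comp_apply, ofComplex_apply] at hz'
    exact hz'
  · intro z hz
    lift z to ℍ using hz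
    simpa only [Function.comp_apply, ofComplex_apply, normalizedDerivOfComplex_hauptmodul] using
      hasDerivAt_comp_ofComplex mdifferentiable_hauptmodul z
  · filter_upwards [hne] with z ⟨hz, hz1⟩
    lift z to ℍ using hz
    rw [ofComplex_apply] at hz1
    simpa only [Function.comp_apply, ofComplex_apply, normalizedDerivOfComplex_E2Two hz1] using
      hasDerivAt_comp_ofComplex mdifferentiable_E2Two z
  · filter_upwards [hne] with z ⟨hz, hz1⟩
    lift z to ℍ using hz
    rw [ofComplex_apply] at hz1
    simpa only [Function.comp_apply, ofComplex_apply, normalizedDerivOfComplex_E2Diff hz1] using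
      hasDerivAt_comp_ofComplex mdifferentiable_E2Diff z
end
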